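/- arXiv:1511.08879 — 2 statements merged into one kernel-verified Lean document; each statement's English description precedes it below -/
import Mathlib

section
/- The (q,α)-deformed Hermite functions φ_n^α(·;q) form an orthonormal system with respect to the Jackson q-integral on ℝ_q with weight |x|^{2α+1}: for all nonnegative integers n,m, (1−q)·Σ_{k∈ℤ} q^{k(2α+2)} [ φ_n^α(q^k;q) φ_m^α(q^k;q) + φ_n^α(−q^k;q) φ_m^α(−q^k;q) ] = δ_{n,m} (and in particular this bilateral series converges). -/
open scoped BigOperators
open Real Filter

noncomputable section

/-- q-shifted factorial `(a;q)_n`. -/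
def qPoch (a q : ℝ) (n : ℕ) : ℝ := ∏ k ∈ Finset.range n, (1 - a * q ^ k)

/-- infinite q-shifted factorial `(a;q)_∞`. -/
def qPochInf (a q : ℝ) : ℝ := ∏' k : ℕ, (1 - a * q ^ k)

/-- q-number `⟦x⟧_q = (1-q^x)/(1-q)`. -/
def qNumber (q x : ℝ) : ℝ := (1 - q ^ x) / (1 - q)

/-- generalized q-integer `⟦n⟧_{q,α}`: equals `⟦n⟧_q` for even `n` and
`⟦n+2α+1⟧_q` for odd `n` (so `⟦2m+1⟧_{q,α} = ⟦2m+2α+2⟧_q`). -/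
def qNumAlpha (q α : ℝ) (n : ℕ) : ℝ :=
  if n % 2 = 0 then qNumber q n else qNumber q (n + 2 * α + 1)

/-- generalized q-factorial `n!_{q,α}`. -/
def qFactAlpha (q α : ℝ) (n : ℕ) : ℝ := ∏ k ∈ Finset.range n, qNumAlpha q α (k + 1)

/-- generalized q-shifted factorial `(q;q)_{n,α} = (1-q)^n n!_{q,α}`. -/
def qPochAlpha (q α : ℝ) (n : ℕ) : ℝ := (1 - q) ^ n * qFactAlpha q α n

/-- generalized discrete q-Hermite II polynomials `h̃_{n,α}(x;q)`. -/
def hTilde (q α : ℝ) (n : ℕ) (x : ℝ) : ℝ :=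
  qPoch q q n * ∑ k ∈ Finset.range (n / 2 + 1),
    (-1 : ℝ) ^ k * q ^ ((k * (2 * k + 1) : ℤ) - (2 * n * k : ℤ)) * x ^ (n - 2 * k) /
      (qPoch (q ^ 2) (q ^ 2) k * qPochAlpha q α (n - 2 * k))

/-- the weight `ω_α(x;q) = e_{q²}(-q^{-2α-1}x²) = 1/∏_{k≥0}(1+q^{-2α-1}x²q^{2k})`. -/
def omegaAlpha (q α x : ℝ) : ℝ :=
  (∏' k : ℕ, (1 + q ^ (-(2 * α + 1)) * x ^ 2 * q ^ (2 * k)))⁻¹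

/-- normalization constant `c_α`. -/
def cAlpha (q α : ℝ) : ℝ :=
  Real.sqrt (qPochInf (-q ^ (-(2 * α + 1))) (q ^ 2) * qPochInf (-q ^ (2 * α + 3)) (q ^ 2) *
      qPochInf (q ^ (2 * α + 2)) (q ^ 2) /
    (2 * (1 - q) *
      (qPochInf (-q) (q ^ 2) * qPochInf (-q) (q ^ 2) * qPochInf (q ^ 2) (q ^ 2))))

/-- normalization constant `d_{n,α} = c_α q^{n²/2} (q;q)_{n,α}^{1/2} / (q;q)_n`. -/
def dAlpha (q α : ℝ) (n : ℕ) : ℝ :=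
  cAlpha q α * q ^ (((n : ℝ) ^ 2) / 2) * Real.sqrt (qPochAlpha q α n) / qPoch q q n

/-- the (q,α)-deformed Hermite functions `φ_n^α(x;q)`. -/
def phiQ (q α : ℝ) (n : ℕ) (x : ℝ) : ℝ :=
  dAlpha q α n * Real.sqrt (omegaAlpha q α x) * hTilde q α n x

/-- parity indicator `θ(n)`: 1 if `n` is odd, 0 if `n` is even. -/
def theta (n : ℕ) : ℝ := if n % 2 = 1 then 1 else 0

/-- the q-Gamma function `Γ_q(z) = (q;q)_∞ / (q^z;q)_∞ · (1-q)^{1-z}`. -/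
def qGammaF (q z : ℝ) : ℝ := qPochInf q q / qPochInf (q ^ z) q * (1 - q) ^ (1 - z)

/-- Rosenblum generalized factorial `γ_ν(n)`. -/
def gammaGen (ν : ℝ) (n : ℕ) : ℝ :=
  2 ^ n * (Nat.factorial (n / 2) : ℝ) *
    Real.Gamma (ν + (((n + 1) / 2 : ℕ) : ℝ) + 1 / 2) / Real.Gamma (ν + 1 / 2)

/-- generalized Hermite polynomials `H_n^ν(x)`. -/
def HGen (ν : ℝ) (n : ℕ) (x : ℝ) : ℝ :=
  (Nat.factorial n : ℝ) * ∑ k ∈ Finset.range (n / 2 + 1),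
    (-1 : ℝ) ^ k * (2 * x) ^ (n - 2 * k) / ((Nat.factorial k : ℝ) * gammaGen ν (n - 2 * k))

/-- Rosenblum generalized Hermite functions `φ_n^ν(x)`. -/
def phiGen (ν : ℝ) (n : ℕ) (x : ℝ) : ℝ :=
  Real.sqrt (gammaGen ν n / Real.Gamma (ν + 1 / 2)) * Real.exp (-x ^ 2 / 2) *
    HGen ν n x / ((2 : ℝ) ^ ((n : ℝ) / 2) * (Nat.factorial n : ℝ))

/-- symmetric q-number `[x]_s = (s^x - s^{-x})/(s - s^{-1})`. -/
def qNumSym (s x : ℝ) : ℝ := (s ^ x - s ^ (-x)) / (s - s⁻¹)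

/-- Euler q-exponential `e_q(z) = Σ z^k/(q;q)_k`. -/
def eExp (q z : ℝ) : ℝ := ∑' k : ℕ, z ^ k / qPoch q q k

/-- generalized q-exponential `E_{q,α}(z) = Σ q^{k(k-1)/2} z^k/(q;q)_{k,α}`. -/
def bigEAlpha (q α z : ℝ) : ℝ := ∑' k : ℕ, q ^ (k * (k - 1) / 2) * z ^ k / qPochAlpha q α k

/-- generalized q-exponential `e_{q,α}(z) = Σ z^k/(q;q)_{k,α}`. -/
def eExpAlpha (q α z : ℝ) : ℝ := ∑' k : ℕ, z ^ k / qPochAlpha q α k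

/-- auxiliary product `E(x) = ∏ (1 + x p^k)`. -/
def EE (p x : ℝ) : ℝ := ∏' k : ℕ, (1 + x * p ^ k)

lemma EE_summable {p : ℝ} (hp0 : 0 < p) (hp1 : p < 1) (x : ℝ) :
    Summable (fun k : ℕ => x * p ^ k) :=
  (summable_geometric_of_lt_one hp0.le hp1).mul_left x

lemma EE_mult {p : ℝ} (hp0 : 0 < p) (hp1 : p < 1) (x : ℝ) :
    Multipliable (fun k : ℕ => 1 + x * p ^ k) :=
  Real.multipliable_one_add_of_summable (EE_summable hp0 hp1 x)

lemma EE_shift {p : ℝ} (hp0 : 0 < p) (hp1 : p < 1) (x : ℝ) :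
    EE p x = (1 + x) * EE p (p * x) := by
  have e : ∀ b : ℕ, 1 + p * x * p ^ b = 1 + x * p ^ (b + 1) := fun b => by rw [pow_succ]; ring
  have h : Multipliable (fun k : ℕ => 1 + x * p ^ (k + 1)) := (EE_mult hp0 hp1 (p * x)).congr e
  have h2 := tprod_eq_zero_mul' (f := fun k : ℕ => 1 + x * p ^ k) h
  have h3 : EE p (p * x) = ∏' k : ℕ, (1 + x * p ^ (k + 1)) := tprod_congr e
  rw [h3, EE, h2, pow_zero, mul_one]

lemma EE_pos {p : ℝ} (hp0 : 0 < p) (hp1 : p < 1) {x : ℝ} (hx : -1 < x) : 0 < EE p x := by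
  have h : ∀ i : ℕ, 0 < 1 + x * p ^ i := by
    intro i
    have h1 : 0 < p ^ i := by positivity
    have h2 : p ^ i ≤ 1 := pow_le_one₀ hp0.le hp1.le
    nlinarith
  unfold EE
  rw [← Real.rexp_tsum_eq_tprod h (Real.summable_log_one_add_of_summable (EE_summable hp0 hp1 x))]
  exact Real.exp_pos _

lemma EE_zero (p : ℝ) : EE p 0 = 1 := by simp [EE]

lemma EE_tendsto {p : ℝ} (hp0 : 0 < p) (hp1 : p < 1) {ι : Type} {l : Filter ι} {f : ι → ℝ} {x : ℝ}
    (hf : Tendsto f l (nhds x)) : Tendsto (fun i => EE p (f i)) l (nhds (EE p x)) := by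
  unfold EE
  refine tendsto_tprod_one_add_of_dominated_convergence (bound := fun k => (|x| + 1) * p ^ k)
    (EE_summable hp0 hp1 _) (fun k => hf.mul_const _) ?_
  have h1 : ∀ᶠ i in l, |f i| < |x| + 1 := hf.abs.eventually_lt_const (by linarith)
  filter_upwards [h1] with i hi k
  rw [norm_mul, Real.norm_eq_abs, norm_pow, Real.norm_eq_abs, abs_of_pos hp0]
  gcongr

lemma EE_prod_le {p : ℝ} (hp0 : 0 < p) (hp1 : p < 1) {x : ℝ} (hx : 0 ≤ x) (n : ℕ) :
    ∏ i ∈ Finset.range n, (1 + x * p ^ i) ≤ EE p x := by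
  have hm : Monotone (fun n => ∏ i ∈ Finset.range n, (1 + x * p ^ i)) := by
    refine monotone_nat_of_le_succ (fun n => ?_)
    rw [Finset.prod_range_succ]
    have : 0 ≤ ∏ i ∈ Finset.range n, (1 + x * p ^ i) :=
      Finset.prod_nonneg (fun i _ => by positivity)
    have h2 : 0 ≤ x * p ^ n := by positivity
    nlinarith
  exact hm.ge_of_tendsto (EE_mult hp0 hp1 x).hasProd.tendsto_prod_nat n

/-- positive-index terms -/
def PP (q z : ℝ) (n : ℕ) : ℝ := ∏ i ∈ Finset.range n, (z + q * (q ^ 2) ^ i)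

/-- negative-index terms -/
def NN (q z : ℝ) (n : ℕ) : ℝ := ∏ i ∈ Finset.range (n + 1), (z + (q * (q ^ 2) ^ i)⁻¹)⁻¹

lemma PP_nonneg {q z : ℝ} (hq0 : 0 < q) (hz : 0 ≤ z) (n : ℕ) : 0 ≤ PP q z n :=
  Finset.prod_nonneg (fun i _ => by positivity)

lemma PP_mono {q z z' : ℝ} (hq0 : 0 < q) (hz : 0 ≤ z) (h : z ≤ z') (n : ℕ) :
    PP q z n ≤ PP q z' n :=
  Finset.prod_le_prod (fun i _ => by positivity) (fun i _ => by linarith)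

lemma PP_tendsto (q : ℝ) {ι : Type} {l : Filter ι} {f : ι → ℝ} {x : ℝ}
    (hf : Tendsto f l (nhds x)) (n : ℕ) : Tendsto (fun i => PP q (f i) n) l (nhds (PP q x n)) := by
  unfold PP
  exact tendsto_finsetProd _ (fun i _ => hf.add_const _)

lemma NN_tendsto {q : ℝ} (hq0 : 0 < q) {ι : Type} {l : Filter ι} {f : ι → ℝ} {x : ℝ} (hx : 0 ≤ x)
    (hf : Tendsto f l (nhds x)) (n : ℕ) : Tendsto (fun i => NN q (f i) n) l (nhds (NN q x n)) := by
  unfold NN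
  exact tendsto_finsetProd _ (fun i _ => (hf.add_const _).inv₀ (by positivity))

lemma NN_nonneg {q z : ℝ} (hq0 : 0 < q) (hz : 0 ≤ z) (n : ℕ) : 0 ≤ NN q z n :=
  Finset.prod_nonneg (fun i _ => by positivity)

lemma NN_le {q z : ℝ} (hq0 : 0 < q) (hq1 : q < 1) (hz : 0 ≤ z) (n : ℕ) :
    NN q z n ≤ q ^ (n + 1) := by
  unfold NN
  calc _ ≤ ∏ i ∈ Finset.range (n + 1), q := by
        refine Finset.prod_le_prod (fun i _ => by positivity) (fun i _ => ?_)
        refine inv_le_of_inv_le₀ hq0 ?_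
        have h1 : q⁻¹ ≤ (q * (q ^ 2) ^ i)⁻¹ := by
          refine inv_anti₀ (by positivity) ?_
          have : (q ^ 2) ^ i ≤ 1 := pow_le_one₀ (by positivity) (by nlinarith)
          nlinarith
        linarith
    _ = _ := by simp

lemma qsummable {q : ℝ} (hq0 : 0 < q) (hq1 : q < 1) : Summable (fun n : ℕ => q ^ (n + 1)) :=
  (summable_nat_add_iff 1).2 (summable_geometric_of_lt_one hq0.le hq1)

lemma NN_summable {q z : ℝ} (hq0 : 0 < q) (hq1 : q < 1) (hz : 0 ≤ z) : Summable (NN q z) :=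
  (qsummable hq0 hq1).of_nonneg_of_le (NN_nonneg hq0 hz) (NN_le hq0 hq1 hz)

lemma PP_succ (q z : ℝ) (n : ℕ) : PP q z (n + 1) = PP q z n * (z + q * (q ^ 2) ^ n) := by
  unfold PP; rw [Finset.prod_range_succ]

lemma NN_succ (q z : ℝ) (n : ℕ) :
    NN q z (n + 1) = NN q z n * (z + (q * (q ^ 2) ^ (n + 1))⁻¹)⁻¹ := by
  unfold NN; rw [Finset.prod_range_succ]

lemma PP_pos {q z : ℝ} (hq0 : 0 < q) (hz : 0 ≤ z) (n : ℕ) : 0 < PP q z n :=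
  Finset.prod_pos (fun i _ => by positivity)

lemma PP_summable {q z : ℝ} (hq0 : 0 < q) (hq1 : q < 1) (hz : 0 ≤ z) (hz1 : z < 1) :
    Summable (PP q z) := by
  refine summable_of_ratio_test_tendsto_lt_one hz1
    (Eventually.of_forall fun n => (PP_pos hq0 hz n).ne') ?_
  have h : ∀ n, ‖PP q z (n + 1)‖ / ‖PP q z n‖ = z + q * (q ^ 2) ^ n := by
    intro n
    have h1 := PP_pos hq0 hz n
    rw [Real.norm_of_nonneg (PP_nonneg hq0 hz _), Real.norm_of_nonneg h1.le, PP_succ]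
    field_simp
  simp only [h]
  have := tendsto_pow_atTop_nhds_zero_of_lt_one (r := q ^ 2) (by positivity) (by nlinarith)
  simpa using (this.const_mul q).const_add z

lemma NN_tsum_tendsto {q : ℝ} (hq0 : 0 < q) (hq1 : q < 1) {ι : Type} {l : Filter ι} {f : ι → ℝ}
    {x : ℝ} (hx : 0 ≤ x) (hf : Tendsto f l (nhds x)) (hf0 : ∀ᶠ i in l, 0 ≤ f i) :
    Tendsto (fun i => ∑' n, NN q (f i) n) l (nhds (∑' n, NN q x n)) := by
  refine tendsto_tsum_of_dominated_convergence (qsummable hq0 hq1)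
    (fun k => NN_tendsto hq0 hx hf k) ?_
  filter_upwards [hf0] with i hi k
  rw [Real.norm_of_nonneg (NN_nonneg hq0 hi _)]
  exact NN_le hq0 hq1 hi k

/-- two-sided sequence -/
def UU (q z : ℝ) (k : ℤ) : ℝ := z ^ k * EE (q ^ 2) (q / z) / EE (q ^ 2) (q / z * (q ^ 2) ^ k)

lemma UU_zero {q z : ℝ} (hq0 : 0 < q) (hq1 : q < 1) (hz : 0 < z) : UU q z 0 = 1 := by
  have : 0 < EE (q ^ 2) (q / z) :=
    EE_pos (by positivity) (by nlinarith) (lt_trans (by norm_num) (show 0 < q / z by positivity))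
  unfold UU
  simp only [zpow_zero, mul_one, one_mul]
  field_simp

lemma UU_succ {q z : ℝ} (hq0 : 0 < q) (hq1 : q < 1) (hz : 0 < z) (k : ℤ) :
    UU q z (k + 1) = UU q z k * (z + q * (q ^ 2) ^ k) := by
  have hp0 : 0 < q ^ 2 := by positivity
  have hp1 : q ^ 2 < 1 := by nlinarith
  have hk : 0 < (q ^ 2) ^ k := by positivity
  have h1 := EE_shift hp0 hp1 (q / z * (q ^ 2) ^ k)
  have e : q / z * (q ^ 2) ^ (k + 1) = q ^ 2 * (q / z * (q ^ 2) ^ k) := by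
    rw [zpow_add_one₀ hp0.ne']; ring
  have h2 : 0 < EE (q ^ 2) (q ^ 2 * (q / z * (q ^ 2) ^ k)) :=
    EE_pos hp0 hp1 (lt_trans (by norm_num) (show 0 < _ by positivity))
  have h3 : 0 < 1 + q / z * (q ^ 2) ^ k := by positivity
  unfold UU
  rw [e, h1, zpow_add_one₀ hz.ne']
  rw [show z + q * (q ^ 2) ^ k = z * (1 + q / z * (q ^ 2) ^ k) by field_simp]
  generalize EE (q ^ 2) (q ^ 2 * (q / z * (q ^ 2) ^ k)) = X at *
  generalize 1 + q / z * (q ^ 2) ^ k = Y at *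
  field_simp

lemma UU_nat {q z : ℝ} (hq0 : 0 < q) (hq1 : q < 1) (hz : 0 < z) (n : ℕ) :
    UU q z n = PP q z n := by
  induction n with
  | zero => simp [UU_zero hq0 hq1 hz, PP]
  | succ n ih =>
    push_cast
    rw [UU_succ hq0 hq1 hz, ih, PP_succ, zpow_natCast]

lemma UU_pred {q z : ℝ} (hq0 : 0 < q) (hq1 : q < 1) (hz : 0 < z) (n : ℕ) :
    UU q z (-(n + 1)) = UU q z (-n) * (z + (q * (q ^ 2) ^ n)⁻¹)⁻¹ := by
  have h := UU_succ hq0 hq1 hz (-(n + 1))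
  have e : q * (q ^ 2) ^ (-((n : ℤ) + 1)) = (q * (q ^ 2) ^ n)⁻¹ := by
    rw [zpow_neg, zpow_add_one₀ (by positivity), zpow_natCast]
    field_simp
  rw [e, show -((n : ℤ) + 1) + 1 = -n by ring] at h
  rw [h]
  have : 0 < z + (q * (q ^ 2) ^ n)⁻¹ := by positivity
  field_simp

lemma UU_neg {q z : ℝ} (hq0 : 0 < q) (hq1 : q < 1) (hz : 0 < z) (n : ℕ) :
    UU q z (-(n + 1)) = NN q z n := by
  induction n with
  | zero =>
    have := UU_pred hq0 hq1 hz 0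
    simp only [Nat.cast_zero, neg_zero, UU_zero hq0 hq1 hz] at this
    simp [NN]
    simpa using this
  | succ n ih =>
    rw [UU_pred hq0 hq1 hz, NN_succ, ← ih]
    push_cast
    rfl

/-- the sum of the two-sided sequence -/
def SS (q z : ℝ) : ℝ := (∑' n, PP q z n) + ∑' n, NN q z n

lemma UU_hasSum {q z : ℝ} (hq0 : 0 < q) (hq1 : q < 1) (hz : 0 < z) (hz1 : z < 1) :
    HasSum (UU q z) (SS q z) := by
  refine HasSum.of_nat_of_neg_add_one ?_ ?_
  · simp only [UU_nat hq0 hq1 hz]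
    exact (PP_summable hq0 hq1 hz.le hz1).hasSum
  · simp only [UU_neg hq0 hq1 hz]
    exact (NN_summable hq0 hq1 hz.le).hasSum

lemma UU_scale {q z : ℝ} (hq0 : 0 < q) (hq1 : q < 1) (hz : 0 < z) (k : ℤ) :
    UU q (q ^ 2 * z) (k + 1) = (1 + q * z) * (UU q z (k + 1) - z * UU q z k) := by
  have hp0 : 0 < q ^ 2 := by positivity
  have hp1 : q ^ 2 < 1 := by nlinarith
  rw [UU_succ hq0 hq1 hz]
  have h1 := EE_shift hp0 hp1 (q / (q ^ 2 * z))
  rw [show q ^ 2 * (q / (q ^ 2 * z)) = q / z by field_simp] at h1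
  unfold UU
  rw [h1, show q / (q ^ 2 * z) * (q ^ 2) ^ (k + 1) = q / z * (q ^ 2) ^ k by
    rw [zpow_add_one₀ hp0.ne']; field_simp]
  have h2 : 0 < EE (q ^ 2) (q / z * (q ^ 2) ^ k) :=
    EE_pos hp0 hp1 (lt_trans (by norm_num) (show 0 < _ by positivity))
  generalize EE (q ^ 2) (q / z * (q ^ 2) ^ k) = X at *
  rw [mul_zpow, zpow_add_one₀ hp0.ne', zpow_add_one₀ hz.ne']
  generalize (q ^ 2) ^ k = Y at *
  field_simp
  ring

lemma SS_scale {q z : ℝ} (hq0 : 0 < q) (hq1 : q < 1) (hz : 0 < z) (hz1 : z < 1) :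
    SS q (q ^ 2 * z) = (1 + q * z) * (1 - z) * SS q z := by
  have hp0 : 0 < q ^ 2 := by positivity
  have hp1 : q ^ 2 < 1 := by nlinarith
  have h := UU_hasSum hq0 hq1 hz hz1
  have h' := UU_hasSum hq0 hq1 (z := q ^ 2 * z) (by positivity) (by nlinarith)
  have h1 := (Equiv.hasSum_iff (Equiv.addRight (1 : ℤ))).2 h
  have h2 := (Equiv.hasSum_iff (Equiv.addRight (1 : ℤ))).2 h'
  have h3 := (h1.sub (h.mul_left z)).mul_left (1 + q * z)
  have := h2.unique (h3.congr_fun (fun k => ?_))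
  · rw [this]; ring
  · simp only [Function.comp, Equiv.coe_addRight]
    exact UU_scale hq0 hq1 hz k

/-- normalized sum -/
def TT (q z : ℝ) : ℝ := EE (q ^ 2) (q * z) * EE (q ^ 2) (-z) * SS q z

lemma TT_scale {q z : ℝ} (hq0 : 0 < q) (hq1 : q < 1) (hz : 0 < z) (hz1 : z < 1) :
    TT q (q ^ 2 * z) = TT q z := by
  have hp0 : 0 < q ^ 2 := by positivity
  have hp1 : q ^ 2 < 1 := by nlinarith
  unfold TT
  rw [SS_scale hq0 hq1 hz hz1, EE_shift hp0 hp1 (q * z), EE_shift hp0 hp1 (-z)]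
  rw [show q * (q ^ 2 * z) = q ^ 2 * (q * z) by ring, show -(q ^ 2 * z) = q ^ 2 * -z by ring]
  ring

lemma TT_pow {q z : ℝ} (hq0 : 0 < q) (hq1 : q < 1) (hz : 0 < z) (hz1 : z < 1) (n : ℕ) :
    TT q ((q ^ 2) ^ n * z) = TT q z := by
  induction n with
  | zero => simp
  | succ n ih =>
    rw [← ih, pow_succ', mul_assoc]
    refine TT_scale hq0 hq1 (by positivity) ?_
    have : (q ^ 2) ^ n ≤ 1 := pow_le_one₀ (by positivity) (by nlinarith)
    nlinarith

lemma TT_const {q z : ℝ} (hq0 : 0 < q) (hq1 : q < 1) (hz : 0 < z) (hz1 : z < 1) :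
    TT q z = SS q 0 := by
  have hp0 : 0 < q ^ 2 := by positivity
  have hp1 : q ^ 2 < 1 := by nlinarith
  have hf : Tendsto (fun n : ℕ => (q ^ 2) ^ n * z) atTop (nhds 0) := by
    simpa using (tendsto_pow_atTop_nhds_zero_of_lt_one hp0.le hp1).mul_const z
  have hf0 : ∀ n : ℕ, 0 ≤ (q ^ 2) ^ n * z := fun n => by positivity
  have hfz : ∀ n : ℕ, (q ^ 2) ^ n * z ≤ z := fun n => by
    have : (q ^ 2) ^ n ≤ 1 := pow_le_one₀ hp0.le hp1.le
    nlinarith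
  have h1 : Tendsto (fun n : ℕ => ∑' m, PP q ((q ^ 2) ^ n * z) m) atTop
      (nhds (∑' m, PP q 0 m)) := by
    refine tendsto_tsum_of_dominated_convergence (PP_summable hq0 hq1 hz.le hz1)
      (fun k => PP_tendsto q hf k) (Eventually.of_forall fun n k => ?_)
    rw [Real.norm_of_nonneg (PP_nonneg hq0 (hf0 n) _)]
    exact PP_mono hq0 (hf0 n) (hfz n) k
  have h2 := NN_tsum_tendsto hq0 hq1 le_rfl hf (Eventually.of_forall hf0)
  have h3 := EE_tendsto hp0 hp1 (hf.const_mul q)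
  have h4 := EE_tendsto hp0 hp1 hf.neg
  have h5 := (h3.mul h4).mul (h1.add h2)
  simp only [mul_zero, neg_zero, EE_zero, one_mul] at h5
  have h6 : (fun n : ℕ => TT q ((q ^ 2) ^ n * z)) = fun _ => TT q z :=
    funext fun n => TT_pow hq0 hq1 hz hz1 n
  have h7 : Tendsto (fun n : ℕ => TT q ((q ^ 2) ^ n * z)) atTop (nhds (SS q 0)) := h5
  rw [h6] at h7
  exact tendsto_nhds_unique tendsto_const_nhds h7

lemma PP_one_eq (q : ℝ) (n : ℕ) :
    PP q 1 n = ∏ i ∈ Finset.range n, (1 + q * (q ^ 2) ^ i) := rfl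

lemma PP_abel {q z : ℝ} (hq0 : 0 < q) (hq1 : q < 1) (hz : 0 ≤ z) (hz1 : z < 1) :
    (1 - z) * ∑' n, PP q z n = 1 + ∑' n, q * (q ^ 2) ^ n * PP q z n := by
  have hs := PP_summable hq0 hq1 hz hz1
  have h1 : ∑' n, PP q z n = 1 + ∑' n, PP q z (n + 1) := by
    rw [hs.tsum_eq_zero_add]; simp [PP]
  have hs' : Summable (fun n => PP q z (n + 1)) := (summable_nat_add_iff 1).2 hs
  have h2 : ∀ n, q * (q ^ 2) ^ n * PP q z n = PP q z (n + 1) - z * PP q z n := by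
    intro n; rw [PP_succ]; ring
  simp only [h2]
  rw [hs'.tsum_sub (hs.mul_left z), tsum_mul_left]
  linarith

lemma TT_zero_val {q : ℝ} (hq0 : 0 < q) (hq1 : q < 1) :
    SS q 0 = EE (q ^ 2) q * EE (q ^ 2) (-(q ^ 2)) * EE (q ^ 2) q := by
  have hp0 : 0 < q ^ 2 := by positivity
  have hp1 : q ^ 2 < 1 := by nlinarith
  let l : Filter ℝ := nhdsWithin 1 (Set.Iio 1)
  have hl : Tendsto (fun z : ℝ => z) l (nhds 1) := tendsto_nhdsWithin_of_tendsto_nhds tendsto_id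
  have hl0 : ∀ᶠ z in l, 0 < z := hl.eventually_const_lt (by norm_num)
  have hl1 : ∀ᶠ z in l, z < 1 := self_mem_nhdsWithin
  have hbs : Summable (fun n : ℕ => q * (q ^ 2) ^ n * EE (q ^ 2) q) :=
    (EE_summable hp0 hp1 q).mul_right _
  have hPP1 : ∀ n, PP q 1 n ≤ EE (q ^ 2) q := fun n => EE_prod_le hp0 hp1 hq0.le n
  have h1 : Tendsto (fun z => ∑' n : ℕ, q * (q ^ 2) ^ n * PP q z n) l
      (nhds (∑' n : ℕ, q * (q ^ 2) ^ n * PP q 1 n)) := by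
    refine tendsto_tsum_of_dominated_convergence hbs
      (fun k => (PP_tendsto q hl k).const_mul _) ?_
    filter_upwards [hl0, hl1] with z hz hz1 k
    have := PP_nonneg hq0 hz.le k
    rw [Real.norm_of_nonneg (by positivity)]
    gcongr
    exact (PP_mono hq0 hz.le hz1.le k).trans (hPP1 k)
  have hsum1 : Summable (fun n : ℕ => q * (q ^ 2) ^ n * PP q 1 n) := by
    refine hbs.of_nonneg_of_le (fun n => ?_) (fun n => ?_)
    · have := PP_nonneg hq0 zero_le_one n
      positivity
    · have := hPP1 n
      gcongr
  have h2 : ∑' n : ℕ, q * (q ^ 2) ^ n * PP q 1 n = EE (q ^ 2) q - 1 := by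
    refine tendsto_nhds_unique hsum1.hasSum.tendsto_sum_nat ?_
    have e : ∀ n : ℕ, q * (q ^ 2) ^ n * PP q 1 n = PP q 1 (n + 1) - PP q 1 n := by
      intro n; rw [PP_succ]; ring
    simp only [e, Finset.sum_range_sub]
    have : PP q 1 0 = 1 := by simp [PP]
    rw [this]
    exact ((EE_mult hp0 hp1 q).hasProd.tendsto_prod_nat).sub_const 1
  have h3 := NN_tsum_tendsto hq0 hq1 zero_le_one hl (hl0.mono fun z hz => hz.le)
  have h4 := EE_tendsto hp0 hp1 (hl.const_mul q)
  have h5 := EE_tendsto hp0 hp1 (hl.const_mul (q ^ 2)).neg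
  have h6 := (h4.mul h5).mul ((h1.const_add 1).add ((hl.const_sub 1).mul h3))
  rw [h2] at h6
  simp only [mul_one, sub_self, zero_mul, add_zero, add_sub_cancel] at h6
  refine tendsto_nhds_unique (tendsto_const_nhds (f := l)) (h6.congr' ?_)
  filter_upwards [hl0, hl1] with z hz hz1
  rw [← TT_const hq0 hq1 hz hz1, ← PP_abel hq0 hq1 hz.le hz1]
  unfold TT SS
  rw [EE_shift hp0 hp1 (-z), show q ^ 2 * -z = -(q ^ 2 * z) by ring]
  ring

lemma SS_val {q z : ℝ} (hq0 : 0 < q) (hq1 : q < 1) (hz : 0 < z) (hz1 : z < 1) :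
    EE (q ^ 2) (q * z) * EE (q ^ 2) (-z) * SS q z
      = EE (q ^ 2) q * EE (q ^ 2) (-(q ^ 2)) * EE (q ^ 2) q := by
  rw [← TT_zero_val hq0 hq1, ← TT_const hq0 hq1 hz hz1, TT]

lemma qPoch_succ (a q : ℝ) (n : ℕ) : qPoch a q (n + 1) = qPoch a q n * (1 - a * q ^ n) := by
  unfold qPoch; rw [Finset.prod_range_succ]

lemma qPoch_pos {a p : ℝ} (ha1 : a < 1) (hp0 : 0 < p) (hp1 : p < 1) (_ha0 : 0 < a) (n : ℕ) :
    0 < qPoch a p n := by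
  refine Finset.prod_pos (fun i _ => ?_)
  have h1 : 0 < p ^ i := by positivity
  have h2 : p ^ i ≤ 1 := pow_le_one₀ hp0.le hp1.le
  nlinarith

lemma qPoch_add (a p : ℝ) (n m : ℕ) :
    qPoch a p (n + m) = qPoch a p n * ∏ i ∈ Finset.range m, (1 - a * p ^ (n + i)) := by
  unfold qPoch; rw [Finset.prod_range_add]

/-- finite q-binomial theorem in base `q²`. -/
lemma qbinom {q : ℝ} (hq0 : 0 < q) (hq1 : q < 1) (x : ℝ) (N : ℕ) :
    ∑ k ∈ Finset.range (N + 1), (-1 : ℝ) ^ k * q ^ ((k : ℤ) * (k - 1)) * x ^ k /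
        (qPoch (q ^ 2) (q ^ 2) k * qPoch (q ^ 2) (q ^ 2) (N - k))
      = qPoch x (q ^ 2) N / qPoch (q ^ 2) (q ^ 2) N := by
  have hp0 : 0 < q ^ 2 := by positivity
  have hp1 : q ^ 2 < 1 := by nlinarith
  have hpos := qPoch_pos hp1 hp0 hp1 hp0
  induction N with
  | zero => simp [qPoch]
  | succ N ih =>
    have hN : 0 < 1 - q ^ 2 * (q ^ 2) ^ N := by
      have h1 : 0 < (q ^ 2) ^ N := by positivity
      have h2 : (q ^ 2) ^ N ≤ 1 := pow_le_one₀ hp0.le hp1.le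
      nlinarith
    rw [qPoch_succ, qPoch_succ, mul_div_mul_comm, ← ih, eq_comm, mul_div_assoc', div_eq_iff hN.ne',
      Finset.sum_mul, Finset.sum_mul]
    have split : ∀ k ∈ Finset.range (N + 1 + 1),
        (-1 : ℝ) ^ k * q ^ ((k : ℤ) * (k - 1)) * x ^ k /
        (qPoch (q ^ 2) (q ^ 2) k * qPoch (q ^ 2) (q ^ 2) (N + 1 - k)) * (1 - q ^ 2 * (q ^ 2) ^ N)
        = (-1 : ℝ) ^ k * q ^ ((k : ℤ) * (k - 1)) * x ^ k /
        (qPoch (q ^ 2) (q ^ 2) k * qPoch (q ^ 2) (q ^ 2) (N + 1 - k)) * (1 - (q ^ 2) ^ (N + 1 - k))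
        + (-1 : ℝ) ^ k * q ^ ((k : ℤ) * (k - 1)) * x ^ k /
        (qPoch (q ^ 2) (q ^ 2) k * qPoch (q ^ 2) (q ^ 2) (N + 1 - k)) *
          ((q ^ 2) ^ (N + 1 - k) * (1 - (q ^ 2) ^ k)) := by
      intro k hk
      have hk' : k ≤ N + 1 := by simpa [Nat.lt_succ_iff] using hk
      rw [← mul_add]
      congr 1
      rw [mul_sub, ← pow_add, ← pow_succ', Nat.sub_add_cancel hk']
      ring
    rw [Finset.sum_congr rfl split, Finset.sum_add_distrib]
    rw [Finset.sum_range_succ _ (N + 1), Finset.sum_range_succ' _ (N + 1)]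
    simp only [Nat.sub_self, pow_zero, sub_self, mul_zero, add_zero]
    rw [← Finset.sum_add_distrib]
    refine Finset.sum_congr rfl (fun k hk => ?_)
    have hk' : k ≤ N := by simpa [Nat.lt_succ_iff] using hk
    obtain ⟨j, rfl⟩ := Nat.exists_eq_add_of_le hk'
    rw [show k + j + 1 - k = j + 1 by omega, show k + j + 1 - (k + 1) = j by omega,
      show k + j - k = j by omega, qPoch_succ _ _ j, qPoch_succ _ _ k]
    have e1 : q ^ (((k + 1 : ℕ) : ℤ) * ((k + 1 : ℕ) - 1)) = q ^ ((k : ℤ) * (k - 1)) * (q ^ 2) ^ k := by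
      rw [← zpow_natCast (q ^ 2) k, ← zpow_natCast q 2, ← zpow_mul, ← zpow_add₀ hq0.ne']
      congr 1
      push_cast
      ring
    rw [e1]
    have hj : 0 < 1 - q ^ 2 * (q ^ 2) ^ j := by
      have h1 : 0 < (q ^ 2) ^ j := by positivity
      have h2 : (q ^ 2) ^ j ≤ 1 := pow_le_one₀ hp0.le hp1.le
      nlinarith
    have hkk : 0 < 1 - q ^ 2 * (q ^ 2) ^ k := by
      have h1 : 0 < (q ^ 2) ^ k := by positivity
      have h2 : (q ^ 2) ^ k ≤ 1 := pow_le_one₀ hp0.le hp1.le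
      nlinarith
    have h1 := hpos k
    have h2 := hpos j
    rw [pow_succ (q ^ 2) j, pow_succ (q ^ 2) k, pow_add (q ^ 2) k j, pow_succ (-1 : ℝ), pow_succ x]
    rw [mul_comm ((q ^ 2) ^ j) (q ^ 2), mul_comm ((q ^ 2) ^ k) (q ^ 2)]
    generalize qPoch (q ^ 2) (q ^ 2) k = A at *
    generalize qPoch (q ^ 2) (q ^ 2) j = B at *
    generalize q ^ ((k : ℤ) * (k - 1)) = C at *
    generalize 1 - q ^ 2 * (q ^ 2) ^ j = D1 at *
    generalize 1 - q ^ 2 * (q ^ 2) ^ k = D2 at *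
    generalize (q ^ 2) ^ j = J at *
    generalize (q ^ 2) ^ k = K at *
    field_simp
    ring

lemma key_mono {q : ℝ} (hq0 : 0 < q) (hq1 : q < 1) (N e : ℕ) (he : e ≤ N) :
    ∑ k ∈ Finset.range (N + 1), (-1 : ℝ) ^ k * q ^ ((k : ℤ) * k + k - 2 * N * k) /
        (qPoch (q ^ 2) (q ^ 2) k * qPoch (q ^ 2) (q ^ 2) (N - k)) * ((q ^ 2) ^ k) ^ e
      = if e = N then 1 else 0 := by
  have hp0 : 0 < q ^ 2 := by positivity
  have hp1 : q ^ 2 < 1 := by nlinarith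
  have hpos := qPoch_pos hp1 hp0 hp1 hp0
  have h := qbinom hq0 hq1 (q ^ (2 * (1 - N + e : ℤ))) N
  have h2 : ∀ k ∈ Finset.range (N + 1),
      (-1 : ℝ) ^ k * q ^ ((k : ℤ) * k + k - 2 * N * k) /
        (qPoch (q ^ 2) (q ^ 2) k * qPoch (q ^ 2) (q ^ 2) (N - k)) * ((q ^ 2) ^ k) ^ e
      = (-1 : ℝ) ^ k * q ^ ((k : ℤ) * (k - 1)) * (q ^ (2 * (1 - N + e : ℤ))) ^ k /
        (qPoch (q ^ 2) (q ^ 2) k * qPoch (q ^ 2) (q ^ 2) (N - k)) := by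
    intro k _
    rw [div_mul_eq_mul_div]
    congr 1
    rw [mul_assoc ((-1 : ℝ) ^ k), mul_assoc ((-1 : ℝ) ^ k)]
    congr 1
    rw [← pow_mul, ← pow_mul, ← zpow_natCast q, ← zpow_natCast _ k, ← zpow_mul,
      ← zpow_add₀ hq0.ne', ← zpow_add₀ hq0.ne']
    congr 1
    push_cast
    ring
  rw [Finset.sum_congr rfl h2, h]
  split_ifs with hN
  · subst hN
    rw [div_eq_one_iff_eq (hpos e).ne']
    congr 1
    rw [show (2 * (1 - (e : ℤ) + e)) = ((2 : ℕ) : ℤ) by push_cast; ring, zpow_natCast]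
  · have hlt : e < N := lt_of_le_of_ne he hN
    have : qPoch (q ^ (2 * (1 - N + e : ℤ))) (q ^ 2) N = 0 := by
      unfold qPoch
      refine Finset.prod_eq_zero (i := N - 1 - e) (by simp; omega) ?_
      rw [← pow_mul, ← zpow_natCast q, ← zpow_add₀ hq0.ne']
      have : 2 * (1 - (N : ℤ) + e) + ((2 * (N - 1 - e) : ℕ) : ℤ) = 0 := by
        push_cast [Nat.cast_sub (show e ≤ N - 1 by omega), Nat.cast_sub (show 1 ≤ N by omega)]
        ring
      rw [this]; simp
    rw [this, zero_div]

lemma key_poly {q : ℝ} (hq0 : 0 < q) (hq1 : q < 1) (N : ℕ) (P : Polynomial ℝ)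
    (hP : P.natDegree ≤ N) :
    ∑ k ∈ Finset.range (N + 1), (-1 : ℝ) ^ k * q ^ ((k : ℤ) * k + k - 2 * N * k) /
        (qPoch (q ^ 2) (q ^ 2) k * qPoch (q ^ 2) (q ^ 2) (N - k)) * P.eval ((q ^ 2) ^ k)
      = P.coeff N := by
  have h : ∀ y, P.eval y = ∑ e ∈ Finset.range (N + 1), P.coeff e * y ^ e := fun y =>
    Polynomial.eval_eq_sum_range' (Nat.lt_succ_of_le hP) y
  simp only [h, Finset.mul_sum]
  rw [Finset.sum_comm]
  have h2 : ∀ e ∈ Finset.range (N + 1), (∑ k ∈ Finset.range (N + 1),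
      (-1 : ℝ) ^ k * q ^ ((k : ℤ) * k + k - 2 * N * k) /
        (qPoch (q ^ 2) (q ^ 2) k * qPoch (q ^ 2) (q ^ 2) (N - k)) * (P.coeff e * ((q ^ 2) ^ k) ^ e))
      = P.coeff e * if e = N then 1 else 0 := by
    intro e he
    rw [← key_mono hq0 hq1 N e (by simpa [Nat.lt_succ_iff] using he), Finset.mul_sum]
    exact Finset.sum_congr rfl fun k _ => by ring
  rw [Finset.sum_congr rfl h2]
  simp

lemma key_prod {q : ℝ} (hq0 : 0 < q) (hq1 : q < 1) (N L : ℕ) (hL : L ≤ N) (f : ℕ → ℝ) :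
    ∑ k ∈ Finset.range (N + 1), (-1 : ℝ) ^ k * q ^ ((k : ℤ) * k + k - 2 * N * k) /
        (qPoch (q ^ 2) (q ^ 2) k * qPoch (q ^ 2) (q ^ 2) (N - k)) *
          ∏ i ∈ Finset.range L, ((q ^ 2) ^ k - f i)
      = if L = N then 1 else 0 := by
  have hdeg : (∏ i ∈ Finset.range L, (Polynomial.X - Polynomial.C (f i))).natDegree = L := by
    simp [Polynomial.natDegree_prod_of_monic _ _ (fun i _ => Polynomial.monic_X_sub_C (f i))]
  have hmon : (∏ i ∈ Finset.range L, (Polynomial.X - Polynomial.C (f i))).Monic :=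
    Polynomial.monic_prod_of_monic _ _ (fun i _ => Polynomial.monic_X_sub_C (f i))
  have h := key_poly hq0 hq1 N _ (hdeg.trans_le hL)
  simp only [Polynomial.eval_prod, Polynomial.eval_sub, Polynomial.eval_X, Polynomial.eval_C] at h
  rw [h]
  split_ifs with hN
  · have := hmon.coeff_natDegree
    rw [hdeg] at this
    rw [← hN, this]
  · exact Polynomial.coeff_eq_zero_of_natDegree_lt (by omega)

lemma moment {q z : ℝ} (hq0 : 0 < q) (hq1 : q < 1) (hz : 0 < z) (hz1 : z < 1) (j : ℕ) :
    HasSum (fun k : ℤ => (z * (q ^ 2) ^ j) ^ k / EE (q ^ 2) (q / z * (q ^ 2) ^ k))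
      (SS q z / EE (q ^ 2) (q / z) * (qPoch z (q ^ 2) j * q ^ (-(j : ℤ) ^ 2))) := by
  have hp0 : 0 < q ^ 2 := by positivity
  have hp1 : q ^ 2 < 1 := by nlinarith
  have hE : ∀ x : ℝ, 0 < x → 0 < EE (q ^ 2) x := fun x hx => EE_pos hp0 hp1 (by linarith)
  have ha : 0 < q / z := by positivity
  induction j with
  | zero =>
    have h := (UU_hasSum hq0 hq1 hz hz1).div_const (EE (q ^ 2) (q / z))
    simp only [pow_zero, mul_one, qPoch, Finset.range_zero, Finset.prod_empty, Nat.cast_zero]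
    simp only [ne_eq, OfNat.ofNat_ne_zero, not_false_eq_true, zero_pow, neg_zero, zpow_zero, mul_one]
    refine h.congr_fun (fun k => ?_)
    have h1 := hE _ ha
    have h2 := hE (q / z * (q ^ 2) ^ k) (by positivity)
    unfold UU
    field_simp
  | succ j ih =>
    have hzj : 0 < z * (q ^ 2) ^ j := by positivity
    have h1 := (Equiv.hasSum_iff (Equiv.addRight (1 : ℤ))).2 ih
    have h2 := ((h1.mul_left (z * (q ^ 2) ^ j)⁻¹).sub ih).mul_left (q / z)⁻¹
    have hval : SS q z / EE (q ^ 2) (q / z) * (qPoch z (q ^ 2) (j + 1) * q ^ (-((j + 1 : ℕ) : ℤ) ^ 2))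
        = (q / z)⁻¹ * ((z * (q ^ 2) ^ j)⁻¹ * (SS q z / EE (q ^ 2) (q / z) *
          (qPoch z (q ^ 2) j * q ^ (-(j : ℤ) ^ 2))) - SS q z / EE (q ^ 2) (q / z) *
            (qPoch z (q ^ 2) j * q ^ (-(j : ℤ) ^ 2))) := by
      rw [qPoch_succ, show -((j + 1 : ℕ) : ℤ) ^ 2 = -(j : ℤ) ^ 2 + (-(1 : ℤ)) + (-((2 * j : ℕ) : ℤ)) by
        push_cast; ring, zpow_add₀ hq0.ne', zpow_add₀ hq0.ne', zpow_neg q (2 * j : ℕ), zpow_natCast,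
        pow_mul, zpow_neg_one]
      have h1 := hE _ ha
      field_simp
    rw [hval]
    refine h2.congr_fun (fun k => ?_)
    · simp only [Function.comp, Equiv.coe_addRight]
      have h3 := EE_shift hp0 hp1 (q / z * (q ^ 2) ^ k)
      rw [show q ^ 2 * (q / z * (q ^ 2) ^ k) = q / z * (q ^ 2) ^ (k + 1) by
        rw [zpow_add_one₀ hp0.ne']; ring] at h3
      rw [h3, zpow_add_one₀ hzj.ne']
      have h4 := hE (q / z * (q ^ 2) ^ (k + 1)) (by positivity)
      have h5 : (z * (q ^ 2) ^ (j + 1)) ^ k = (z * (q ^ 2) ^ j) ^ k * (q ^ 2) ^ k := by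
        rw [pow_succ, ← mul_assoc, mul_zpow]
      rw [h5]
      have h6 : 0 < 1 + q / z * (q ^ 2) ^ k := by positivity
      generalize EE (q ^ 2) (q / z * (q ^ 2) ^ (k + 1)) = X at *
      generalize (z * (q ^ 2) ^ j) ^ k = Y at *
      have hW : 0 < (q ^ 2) ^ k := by positivity
      generalize (q ^ 2) ^ k = W at *
      field_simp
      ring

/-- coefficients of the polynomials, in terms of `z = q^(2α+2)`. -/
def cc (q z : ℝ) (N s k : ℕ) : ℝ :=
  qPoch q q (2 * N + s) * ((-1 : ℝ) ^ k * q ^ ((k : ℤ) * (2 * k + 1) - 2 * (2 * N + s) * k) /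
    (qPoch (q ^ 2) (q ^ 2) k * (qPoch (q ^ 2) (q ^ 2) (N - k) * qPoch z (q ^ 2) (N - k + s))))

/-- the polynomials, in terms of `z = q^(2α+2)`. -/
def HH (q z : ℝ) (N s : ℕ) (x : ℝ) : ℝ :=
  ∑ k ∈ Finset.range (N + 1), cc q z N s k * x ^ (2 * (N - k) + s)

/-- normalized moments -/
def mo (q z : ℝ) (j : ℕ) : ℝ := qPoch z (q ^ 2) j * q ^ (-(j : ℤ) ^ 2)

lemma inner_mono {q z : ℝ} (hq0 : 0 < q) (hq1 : q < 1) (hz : 0 < z) (hz1 : z < 1)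
    (N L s : ℕ) (hL : L ≤ N) :
    ∑ k ∈ Finset.range (N + 1), cc q z N s k * mo q z ((N - k) + L + s)
      = if L = N then qPoch q q (2 * N + s) * q ^ (-((2 * N + s : ℕ) : ℤ) ^ 2) else 0 := by
  have hp0 : 0 < q ^ 2 := by positivity
  have hp1 : q ^ 2 < 1 := by nlinarith
  have h := key_prod hq0 hq1 N L hL (fun i => z * (q ^ 2) ^ (N + s + i))
  have h2 : ∀ k ∈ Finset.range (N + 1), cc q z N s k * mo q z ((N - k) + L + s)
      = qPoch q q (2 * N + s) * q ^ (-((N + L + s : ℕ) : ℤ) ^ 2) *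
        ((-1 : ℝ) ^ k * q ^ ((k : ℤ) * k + k - 2 * N * k) /
        (qPoch (q ^ 2) (q ^ 2) k * qPoch (q ^ 2) (q ^ 2) (N - k)) *
          ∏ i ∈ Finset.range L, ((q ^ 2) ^ k - z * (q ^ 2) ^ (N + s + i))) := by
    intro k hk
    have hk' : k ≤ N := by simpa [Nat.lt_succ_iff] using hk
    obtain ⟨j, rfl⟩ := Nat.exists_eq_add_of_le hk'
    unfold cc mo
    rw [show k + j - k = j by omega, show j + L + s = (j + s) + L by omega, qPoch_add z (q ^ 2) (j + s) L]
    have hprod : ∏ i ∈ Finset.range L, ((q ^ 2) ^ k - z * (q ^ 2) ^ (k + j + s + i))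
        = q ^ (2 * k * L : ℤ) * ∏ i ∈ Finset.range L, (1 - z * (q ^ 2) ^ (j + s + i)) := by
      have : ∀ i ∈ Finset.range L, (q ^ 2) ^ k - z * (q ^ 2) ^ (k + j + s + i)
          = (q ^ 2) ^ k * (1 - z * (q ^ 2) ^ (j + s + i)) := by
        intro i _
        rw [show k + j + s + i = k + (j + s + i) by omega, pow_add]; ring
      rw [Finset.prod_congr rfl this, Finset.prod_mul_distrib, Finset.prod_const, Finset.card_range,
        ← pow_mul, ← pow_mul, ← zpow_natCast]
      congr 2
      push_cast
      ring
    rw [hprod]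
    have hexp : q ^ ((k : ℤ) * (2 * k + 1) - 2 * (2 * (k + j : ℕ) + s) * k) *
          q ^ (-((j + s + L : ℕ) : ℤ) ^ 2)
        = q ^ (-((k + j + L + s : ℕ) : ℤ) ^ 2) * q ^ ((k : ℤ) * k + k - 2 * (k + j : ℕ) * k) *
          q ^ (2 * k * L : ℤ) := by
      rw [← zpow_add₀ hq0.ne', ← zpow_add₀ hq0.ne', ← zpow_add₀ hq0.ne']
      congr 1
      push_cast
      ring
    have h1 := qPoch_pos hz1 hp0 hp1 hz (j + s)
    have h3 := qPoch_pos hp1 hp0 hp1 hp0 k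
    have h4 := qPoch_pos hp1 hp0 hp1 hp0 j
    generalize qPoch z (q ^ 2) (j + s) = Z at *
    generalize qPoch (q ^ 2) (q ^ 2) k = A at *
    generalize qPoch (q ^ 2) (q ^ 2) j = B at *
    generalize ∏ i ∈ Finset.range L, (1 - z * (q ^ 2) ^ (j + s + i)) = P at *
    generalize qPoch q q (2 * (k + j) + s) = Q at *
    calc _ = Q * (-1) ^ k * P / (A * B) * (q ^ ((k : ℤ) * (2 * k + 1) - 2 * (2 * (k + j : ℕ) + s) * k) *
          q ^ (-((j + s + L : ℕ) : ℤ) ^ 2)) := by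
            generalize q ^ ((k : ℤ) * (2 * k + 1) - 2 * (2 * (k + j : ℕ) + s) * k) = X
            generalize q ^ (-((j + s + L : ℕ) : ℤ) ^ 2) = Y
            field_simp
      _ = _ := by
            rw [hexp]; ring
  rw [Finset.sum_congr rfl h2, ← Finset.mul_sum, h]
  split_ifs with hN
  · subst hN
    rw [mul_one, show L + L + s = 2 * L + s by omega]
  · simp

lemma inner_HH {q z : ℝ} (hq0 : 0 < q) (hq1 : q < 1) (hz : 0 < z) (hz1 : z < 1)
    (N L s : ℕ) (hL : L ≤ N) :
    HasSum (fun k : ℤ => z ^ k / EE (q ^ 2) (q / z * (q ^ 2) ^ k) *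
        (HH q z N s (q ^ k) * HH q z L s (q ^ k)))
      (if L = N then SS q z / EE (q ^ 2) (q / z) * (cc q z N s 0 *
        (qPoch q q (2 * N + s) * q ^ (-((2 * N + s : ℕ) : ℤ) ^ 2))) else 0) := by
  have h1 : HasSum (fun k : ℤ => ∑ l ∈ Finset.range (L + 1), ∑ i ∈ Finset.range (N + 1),
      cc q z L s l * cc q z N s i * ((z * (q ^ 2) ^ ((N - i) + (L - l) + s)) ^ k /
        EE (q ^ 2) (q / z * (q ^ 2) ^ k)))
      (∑ l ∈ Finset.range (L + 1), ∑ i ∈ Finset.range (N + 1),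
        cc q z L s l * cc q z N s i * (SS q z / EE (q ^ 2) (q / z) *
          mo q z ((N - i) + (L - l) + s))) :=
    hasSum_sum fun l _ => hasSum_sum fun i _ => (moment hq0 hq1 hz hz1 _).mul_left _
  have hval : (∑ l ∈ Finset.range (L + 1), ∑ i ∈ Finset.range (N + 1),
        cc q z L s l * cc q z N s i * (SS q z / EE (q ^ 2) (q / z) *
          mo q z ((N - i) + (L - l) + s)))
      = (if L = N then SS q z / EE (q ^ 2) (q / z) * (cc q z N s 0 *
        (qPoch q q (2 * N + s) * q ^ (-((2 * N + s : ℕ) : ℤ) ^ 2))) else 0) := by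
    have h2 : ∀ l ∈ Finset.range (L + 1), (∑ i ∈ Finset.range (N + 1),
        cc q z L s l * cc q z N s i * (SS q z / EE (q ^ 2) (q / z) *
          mo q z ((N - i) + (L - l) + s)))
        = SS q z / EE (q ^ 2) (q / z) * cc q z L s l * (if L - l = N then
          qPoch q q (2 * N + s) * q ^ (-((2 * N + s : ℕ) : ℤ) ^ 2) else 0) := by
      intro l _
      rw [← inner_mono hq0 hq1 hz hz1 N (L - l) s (by omega), Finset.mul_sum]
      exact Finset.sum_congr rfl fun i _ => by ring
    rw [Finset.sum_congr rfl h2, Finset.sum_range_succ', Finset.sum_eq_zero, zero_add, Nat.sub_zero]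
    · split_ifs with hN
      · subst hN; ring
      · simp
    · intro l hl
      have : l < L := by simpa using hl
      rw [if_neg (by omega), mul_zero]
  rw [← hval]
  refine h1.congr_fun (fun k => ?_)
  unfold HH
  rw [Finset.sum_mul_sum, Finset.sum_comm, Finset.mul_sum]
  refine Finset.sum_congr rfl fun l _ => ?_
  rw [Finset.mul_sum]
  refine Finset.sum_congr rfl fun i _ => ?_
  have e : (z * (q ^ 2) ^ ((N - i) + (L - l) + s)) ^ k
      = z ^ k * ((q ^ k) ^ (2 * (N - i) + s) * (q ^ k) ^ (2 * (L - l) + s)) := by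
    rw [mul_zpow, ← pow_add, ← pow_mul, ← zpow_natCast q, ← zpow_natCast (q ^ k), ← zpow_mul,
      ← zpow_mul, mul_comm (k : ℤ)]
    congr 3
    omega
  rw [e]
  ring

lemma qNum_odd {q α : ℝ} (hq0 : 0 < q) (hq1 : q < 1) (j : ℕ) :
    (1 - q) * qNumAlpha q α (2 * j + 1) = 1 - q ^ (2 * α + 2) * (q ^ 2) ^ j := by
  have h : (1 - q) ≠ 0 := by linarith
  unfold qNumAlpha qNumber
  rw [if_neg (by omega), mul_div_cancel₀ _ h, ← pow_mul, ← Real.rpow_natCast, ← Real.rpow_add hq0]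
  congr 2
  push_cast
  ring

lemma qNum_even {q α : ℝ} (hq1 : q < 1) (j : ℕ) :
    (1 - q) * qNumAlpha q α (2 * j + 2) = 1 - q ^ 2 * (q ^ 2) ^ j := by
  have h : (1 - q) ≠ 0 := by linarith
  unfold qNumAlpha qNumber
  rw [if_pos (by omega), mul_div_cancel₀ _ h, ← pow_succ', ← pow_mul, Real.rpow_natCast]
  congr 2

lemma qPochAlpha_succ (q α : ℝ) (n : ℕ) :
    qPochAlpha q α (n + 1) = qPochAlpha q α n * ((1 - q) * qNumAlpha q α (n + 1)) := by
  unfold qPochAlpha qFactAlpha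
  rw [Finset.prod_range_succ, pow_succ]; ring

lemma qPochAlpha_even {q α : ℝ} (hq0 : 0 < q) (hq1 : q < 1) (j : ℕ) :
    qPochAlpha q α (2 * j) = qPoch (q ^ 2) (q ^ 2) j * qPoch (q ^ (2 * α + 2)) (q ^ 2) j := by
  induction j with
  | zero => simp [qPochAlpha, qFactAlpha, qPoch]
  | succ j ih =>
    rw [show 2 * (j + 1) = 2 * j + 1 + 1 by ring, qPochAlpha_succ, qPochAlpha_succ, ih,
      qNum_odd hq0 hq1, show 2 * j + 1 + 1 = 2 * j + 2 by ring, qNum_even hq1, qPoch_succ, qPoch_succ]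
    ring

lemma qPochAlpha_gen {q α : ℝ} (hq0 : 0 < q) (hq1 : q < 1) (j s : ℕ) (hs : s < 2) :
    qPochAlpha q α (2 * j + s) =
      qPoch (q ^ 2) (q ^ 2) j * qPoch (q ^ (2 * α + 2)) (q ^ 2) (j + s) := by
  interval_cases s
  · simpa using qPochAlpha_even hq0 hq1 j
  · rw [qPochAlpha_succ, qPochAlpha_even hq0 hq1, qNum_odd hq0 hq1, qPoch_succ]
    ring

lemma hTilde_eq {q α : ℝ} (hq0 : 0 < q) (hq1 : q < 1) (N s : ℕ) (hs : s < 2) (x : ℝ) :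
    hTilde q α (2 * N + s) x = HH q (q ^ (2 * α + 2)) N s x := by
  unfold hTilde HH
  rw [show (2 * N + s) / 2 = N by omega, Finset.mul_sum]
  refine Finset.sum_congr rfl fun k hk => ?_
  have hk' : k ≤ N := by simpa [Nat.lt_succ_iff] using hk
  rw [show 2 * N + s - 2 * k = 2 * (N - k) + s by omega, qPochAlpha_gen hq0 hq1 _ _ hs]
  unfold cc
  push_cast
  ring

lemma HH_neg (q z : ℝ) (N s : ℕ) (x : ℝ) : HH q z N s (-x) = (-1) ^ s * HH q z N s x := by
  unfold HH
  rw [Finset.mul_sum]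
  refine Finset.sum_congr rfl fun k _ => ?_
  rw [neg_pow, pow_add, pow_mul]
  simp
  ring

lemma omega_eq {q α : ℝ} (hq0 : 0 < q) (y : ℝ) (k : ℤ) (hy : y ^ 2 = (q ^ 2) ^ k) :
    omegaAlpha q α y = (EE (q ^ 2) (q / q ^ (2 * α + 2) * (q ^ 2) ^ k))⁻¹ := by
  have h : q ^ (-(2 * α + 1)) = q / q ^ (2 * α + 2) := by
    rw [show -(2 * α + 1) = 1 - (2 * α + 2) by ring, Real.rpow_sub hq0, Real.rpow_one]
  unfold omegaAlpha EE
  rw [h, hy]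
  simp only [pow_mul]

lemma qPochInf_eq (a p : ℝ) : qPochInf (-a) p = EE p a := by
  unfold qPochInf EE
  refine tprod_congr fun k => by ring

lemma cAlpha_sq {q α : ℝ} (hq0 : 0 < q) (hq1 : q < 1) (hα : -1 < α) :
    2 * (1 - q) * (cAlpha q α ^ 2 * (SS q (q ^ (2 * α + 2)) / EE (q ^ 2) (q / q ^ (2 * α + 2)))) = 1 := by
  have hp0 : 0 < q ^ 2 := by positivity
  have hp1 : q ^ 2 < 1 := by nlinarith
  have hz : 0 < q ^ (2 * α + 2) := Real.rpow_pos_of_pos hq0 _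
  have hz1 : q ^ (2 * α + 2) < 1 := Real.rpow_lt_one hq0.le hq1 (by linarith)
  have h1 : q ^ (-(2 * α + 1)) = q / q ^ (2 * α + 2) := by
    rw [show -(2 * α + 1) = 1 - (2 * α + 2) by ring, Real.rpow_sub hq0, Real.rpow_one]
  have h2 : q ^ (2 * α + 3) = q * q ^ (2 * α + 2) := by
    rw [show 2 * α + 3 = 1 + (2 * α + 2) by ring, Real.rpow_add hq0, Real.rpow_one]
  have h3 : qPochInf (q ^ (2 * α + 2)) (q ^ 2) = EE (q ^ 2) (-(q ^ (2 * α + 2))) := by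
    rw [← qPochInf_eq, neg_neg]
  have h4 : qPochInf (q ^ 2) (q ^ 2) = EE (q ^ 2) (-(q ^ 2)) := by
    rw [← qPochInf_eq, neg_neg]
  have hS := SS_val hq0 hq1 hz hz1
  unfold cAlpha
  rw [qPochInf_eq, qPochInf_eq, qPochInf_eq, h3, h4, h1, h2]
  generalize q ^ (2 * α + 2) = z at *
  have hE : ∀ x : ℝ, 0 < x → 0 < EE (q ^ 2) x := fun x hx => EE_pos hp0 hp1 (by linarith)
  have e1 := hE (q / z) (by positivity)
  have e2 := hE (q * z) (by positivity)
  have e3 := hE q hq0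
  have e4 : 0 < EE (q ^ 2) (-z) := EE_pos hp0 hp1 (by linarith)
  have e5 : 0 < EE (q ^ 2) (-(q ^ 2)) := EE_pos hp0 hp1 (by linarith)
  have e6 : 0 < 1 - q := by linarith
  rw [Real.sq_sqrt (by positivity)]
  generalize EE (q ^ 2) (q / z) = X1 at *
  generalize EE (q ^ 2) (q * z) = X2 at *
  generalize EE (q ^ 2) q = X3 at *
  generalize EE (q ^ 2) (-z) = X4 at *
  generalize EE (q ^ 2) (-(q ^ 2)) = X5 at *
  have hS' : SS q z = X3 * X5 * X3 / (X2 * X4) := by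
    rw [eq_div_iff (by positivity), ← hS]; ring
  rw [hS']
  generalize 1 - q = r at *
  field_simp

lemma ortho_aux {q α : ℝ} (hq0 : 0 < q) (hq1 : q < 1) (hα : -1 < α) (N L s t : ℕ)
    (hs : s < 2) (ht : t < 2) (k : ℤ) :
    (1 - q) * q ^ ((k : ℝ) * (2 * α + 2)) *
        (phiQ q α (2 * N + s) (q ^ k) * phiQ q α (2 * L + t) (q ^ k) +
          phiQ q α (2 * N + s) (-(q ^ k)) * phiQ q α (2 * L + t) (-(q ^ k)))
    = (1 - q) * (1 + (-1) ^ (s + t)) * (dAlpha q α (2 * N + s) * dAlpha q α (2 * L + t)) *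
      ((q ^ (2 * α + 2)) ^ k / EE (q ^ 2) (q / q ^ (2 * α + 2) * (q ^ 2) ^ k) *
        (HH q (q ^ (2 * α + 2)) N s (q ^ k) * HH q (q ^ (2 * α + 2)) L t (q ^ k))) := by
  have hp0 : 0 < q ^ 2 := by positivity
  have hp1 : q ^ 2 < 1 := by nlinarith
  have hz : 0 < q ^ (2 * α + 2) := Real.rpow_pos_of_pos hq0 _
  have e1 : q ^ ((k : ℝ) * (2 * α + 2)) = (q ^ (2 * α + 2)) ^ k := by
    rw [mul_comm, Real.rpow_mul hq0.le, Real.rpow_intCast]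
  have hy : (q ^ k) ^ 2 = (q ^ 2) ^ k := by
    rw [← zpow_natCast, ← zpow_natCast, ← zpow_mul, ← zpow_mul, mul_comm]
  unfold phiQ
  rw [omega_eq hq0 (q ^ k) k hy, omega_eq hq0 (-(q ^ k)) k (by rw [neg_sq, hy]),
    hTilde_eq hq0 hq1 _ _ hs, hTilde_eq hq0 hq1 _ _ hs, hTilde_eq hq0 hq1 _ _ ht,
    hTilde_eq hq0 hq1 _ _ ht, HH_neg, HH_neg, e1]
  have hE : 0 < EE (q ^ 2) (q / q ^ (2 * α + 2) * (q ^ 2) ^ k) :=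
    EE_pos hp0 hp1 (lt_trans (by norm_num) (show 0 < _ by positivity))
  have hsq := Real.mul_self_sqrt (inv_nonneg.2 hE.le)
  rw [div_eq_mul_inv ((q ^ (2 * α + 2)) ^ k)]
  generalize √(EE (q ^ 2) (q / q ^ (2 * α + 2) * (q ^ 2) ^ k))⁻¹ = w at *
  rw [← hsq, pow_add]
  ring

lemma ortho_le {q α : ℝ} (hq0 : 0 < q) (hq1 : q < 1) (hα : -1 < α) (N L s : ℕ)
    (hs : s < 2) (hL : L ≤ N) :
    HasSum (fun k : ℤ => (1 - q) * q ^ ((k : ℝ) * (2 * α + 2)) *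
        (phiQ q α (2 * N + s) (q ^ k) * phiQ q α (2 * L + s) (q ^ k) +
          phiQ q α (2 * N + s) (-(q ^ k)) * phiQ q α (2 * L + s) (-(q ^ k))))
      (if L = N then 1 else 0) := by
  have hp0 : 0 < q ^ 2 := by positivity
  have hp1 : q ^ 2 < 1 := by nlinarith
  have hz : 0 < q ^ (2 * α + 2) := Real.rpow_pos_of_pos hq0 _
  have hz1 : q ^ (2 * α + 2) < 1 := Real.rpow_lt_one hq0.le hq1 (by linarith)
  simp only [ortho_aux hq0 hq1 hα N L s s hs hs]
  have h := (inner_HH hq0 hq1 hz hz1 N L s hL).mul_left ((1 - q) * (1 + (-1) ^ (s + s)) *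
    (dAlpha q α (2 * N + s) * dAlpha q α (2 * L + s)))
  have hval : (1 - q) * (1 + (-1) ^ (s + s)) * (dAlpha q α (2 * N + s) * dAlpha q α (2 * L + s)) *
      (if L = N then SS q (q ^ (2 * α + 2)) / EE (q ^ 2) (q / q ^ (2 * α + 2)) *
        (cc q (q ^ (2 * α + 2)) N s 0 *
          (qPoch q q (2 * N + s) * q ^ (-((2 * N + s : ℕ) : ℤ) ^ 2))) else 0)
      = if L = N then 1 else 0 := by
    split_ifs with hN
    · symm
      subst hN
      have hc := cAlpha_sq hq0 hq1 hα
      have hA := qPochAlpha_gen (α := α) hq0 hq1 L s hs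
      have hA0 : 0 < qPochAlpha q α (2 * L + s) := by
        rw [hA]; exact mul_pos (qPoch_pos hp1 hp0 hp1 hp0 _) (qPoch_pos hz1 hp0 hp1 hz _)
      have hQ := qPoch_pos hq1 hq0 hq1 hq0 (2 * L + s)
      have hcc : cc q (q ^ (2 * α + 2)) L s 0 = qPoch q q (2 * L + s) / qPochAlpha q α (2 * L + s) := by
        unfold cc
        rw [hA]
        simp [qPoch]
        ring
      have hsq := Real.mul_self_sqrt hA0.le
      have hpw : q ^ (((2 * L + s : ℕ) : ℝ) ^ 2 / 2) * q ^ (((2 * L + s : ℕ) : ℝ) ^ 2 / 2) *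
          q ^ (-((2 * L + s : ℕ) : ℤ) ^ 2) = 1 := by
        rw [← Real.rpow_add hq0, ← Real.rpow_intCast, ← Real.rpow_add hq0]
        push_cast
        rw [show ((2 * (L : ℝ) + s) ^ 2 / 2 + (2 * (L : ℝ) + s) ^ 2 / 2 + -(2 * (L : ℝ) + s) ^ 2) = 0 by ring,
          Real.rpow_zero]
      have hsgn : (-1 : ℝ) ^ (s + s) = 1 := by rw [← two_mul, pow_mul]; simp
      rw [hcc, hsgn]
      unfold dAlpha
      generalize SS q (q ^ (2 * α + 2)) / EE (q ^ 2) (q / q ^ (2 * α + 2)) = M at *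
      generalize q ^ (((2 * L + s : ℕ) : ℝ) ^ 2 / 2) = W at *
      generalize q ^ (-((2 * L + s : ℕ) : ℤ) ^ 2) = V at *
      generalize √(qPochAlpha q α (2 * L + s)) = R at *
      generalize qPoch q q (2 * L + s) = Q at *
      rw [← hsq] at hA0 ⊢
      have hR : R ≠ 0 := by rintro rfl; simp at hA0
      calc (1 : ℝ) = (2 * (1 - q) * (cAlpha q α ^ 2 * M)) * (W * W * V) := by rw [hc, hpw, one_mul]
        _ = _ := by
          field_simp
          try ring
    · simp
  rw [hval] at h
  exact h

/-- orthonormality of the (q,α)-deformed Hermite functions. -/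
theorem stmt_3 (q α : ℝ) (hq0 : 0 < q) (hq1 : q < 1) (hα : -1 < α) (n m : ℕ) :
    HasSum (fun k : ℤ => (1 - q) * q ^ ((k : ℝ) * (2 * α + 2)) *
        (phiQ q α n (q ^ k) * phiQ q α m (q ^ k) +
          phiQ q α n (-(q ^ k)) * phiQ q α m (-(q ^ k))))
      (if n = m then 1 else 0) := by
  obtain ⟨N, s, hs, rfl⟩ : ∃ N s, s < 2 ∧ n = 2 * N + s := ⟨n / 2, n % 2, by omega, by omega⟩
  obtain ⟨L, t, ht, rfl⟩ : ∃ L t, t < 2 ∧ m = 2 * L + t := ⟨m / 2, m % 2, by omega, by omega⟩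
  by_cases hst : s = t
  · subst hst
    rcases le_total L N with h | h
    · have := ortho_le hq0 hq1 hα N L s hs h
      rwa [show (if 2 * N + s = 2 * L + s then (1 : ℝ) else 0) = if L = N then 1 else 0 by
        congr 1; simp [eq_comm]]
    · have := ortho_le hq0 hq1 hα L N s hs h
      rw [show (if 2 * N + s = 2 * L + s then (1 : ℝ) else 0) = if N = L then 1 else 0 by
        congr 1; simp]
      refine this.congr_fun (fun k => ?_)
      ring
  · rw [if_neg (by omega)]
    have h1 : s + t = 1 := by omega
    simp only [ortho_aux hq0 hq1 hα N L s t hs ht, h1]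
    simp only [pow_one, add_neg_cancel, mul_zero, zero_mul]
    exact hasSum_zero
end
end

section
/- Limit of the wave functions to the generalized Hermite functions: for every nonnegative integer n, real α>−1 and real x, lim_{q→1⁻} (1−q²)^{(α+1)/2} · φ_n^α(√(1−q²)·x ; q) = φ_n^{α+1/2}(x), where φ_n^ν(x) = (γ_ν(n)/Γ(ν+1/2))^{1/2} · exp(−x²/2) · H_n^ν(x)/(2^{n/2} n!) is the Rosenblum generalized Hermite function. -/
open scoped BigOperators
open Real Filter

noncomputable section

open Topology Set

lemma squeeze_two {l : Filter ℝ} {G : ℝ → ℝ} {A B : ℕ → ℝ → ℝ} {a b : ℕ → ℝ} {L : ℝ}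
    (hA : ∀ n, 1 ≤ n → Tendsto (A n) l (𝓝 (a n))) (hB : ∀ n, 1 ≤ n → Tendsto (B n) l (𝓝 (b n)))
    (ha : Tendsto a atTop (𝓝 L)) (hb : Tendsto b atTop (𝓝 L))
    (h1 : ∀ n, 1 ≤ n → ∀ᶠ q in l, A n q ≤ G q) (h2 : ∀ n, 1 ≤ n → ∀ᶠ q in l, G q ≤ B n q) :
    Tendsto G l (𝓝 L) := by
  rw [tendsto_order]
  constructor
  · intro c hc
    obtain ⟨n, hn, hn1⟩ := ((ha.eventually (lt_mem_nhds hc)).and (eventually_ge_atTop 1)).exists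
    filter_upwards [h1 n hn1, (hA n hn1).eventually (lt_mem_nhds hn)] with q hq hq'
    linarith
  · intro c hc
    obtain ⟨n, hn, hn1⟩ := ((hb.eventually (gt_mem_nhds hc)).and (eventually_ge_atTop 1)).exists
    filter_upwards [h2 n hn1, (hB n hn1).eventually (gt_mem_nhds hn)] with q hq hq'
    linarith

/-- chord comparison for one convex function -/
lemma convex_chord {h : ℝ → ℝ} {a u v : ℝ} (hc : ConvexOn ℝ (Ioi a) h) (hu : a < u - 1)
    (huv : u ≤ v) :
    (v - u) * (h u - h (u - 1)) ≤ h v - h u ∧ h v - h u ≤ (v - u) * (h (v + 1) - h v) := by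
  rcases huv.eq_or_lt with rfl | huv
  · simp
  have h1 := hc.slope_mono_adjacent (x := u - 1) (y := u) (z := v) hu
    (show a < v by linarith) (by linarith) huv
  have h2 := hc.slope_mono_adjacent (x := u) (y := v) (z := v + 1) (show a < u by linarith)
    (show a < v + 1 by linarith) huv (by linarith)
  have hp : 0 < v - u := by linarith
  constructor
  · rw [le_div_iff₀ hp] at h1
    have : u - (u - 1) = 1 := by ring
    rw [this] at h1; linarith
  · rw [div_le_iff₀ hp] at h2
    have : v + 1 - v = 1 := by ring
    rw [this] at h2; linarith

lemma convex_tele {h : ℝ → ℝ} {a u v : ℝ} (hc : ConvexOn ℝ (Ioi a) h) (hu : a < u - 1)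
    (huv : u ≤ v) (hs : ∀ t, Summable (fun k : ℕ => h (t + k))) :
    (v - u) * (-h (u - 1)) ≤ (∑' k : ℕ, h (v + k)) - ∑' k : ℕ, h (u + k) ∧
    (∑' k : ℕ, h (v + k)) - ∑' k : ℕ, h (u + k) ≤ (v - u) * (-h v) := by
  have tele : ∀ t, (∑' k : ℕ, h (t + 1 + k)) - ∑' k : ℕ, h (t + k) = - h t := by
    intro t
    rw [(hs t).tsum_eq_zero_add]
    have : ∀ k : ℕ, h (t + (k + 1 : ℕ)) = h (t + 1 + k) := by
      intro k; congr 1; push_cast; ring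
    simp only [this]; simp
  have key : ∀ k : ℕ, (v - u) * (h (u + k) - h (u - 1 + k)) ≤ h (v + k) - h (u + k) ∧
      h (v + k) - h (u + k) ≤ (v - u) * (h (v + 1 + k) - h (v + k)) := by
    intro k
    have hk : (0 : ℝ) ≤ k := Nat.cast_nonneg k
    have := convex_chord hc (u := u + k) (v := v + k) (by linarith) (by linarith)
    rw [show v + k - (u + k) = v - u by ring, show u + (k : ℝ) - 1 = u - 1 + k by ring,
      show v + (k : ℝ) + 1 = v + 1 + k by ring] at this
    exact this
  rw [← tele v, ← tele (u - 1), show u - 1 + 1 = u by ring]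
  rw [← (hs u).tsum_sub (hs (u - 1)), ← (hs v).tsum_sub (hs u), ← (hs (v + 1)).tsum_sub (hs v),
    ← tsum_mul_left, ← tsum_mul_left]
  exact ⟨(((hs u).sub (hs (u - 1))).mul_left _).tsum_le_tsum (fun k => (key k).1)
      ((hs v).sub (hs u)),
    ((hs v).sub (hs u)).tsum_le_tsum (fun k => (key k).2)
      (((hs (v + 1)).sub (hs v)).mul_left _)⟩

lemma summable_pow_shift {p : ℝ} (hp : p ∈ Ioo (0 : ℝ) 1) (c t : ℝ) :
    Summable (fun k : ℕ => c * p ^ (t + k)) := by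
  have : (fun k : ℕ => c * p ^ (t + k)) = fun k : ℕ => (c * p ^ t) * p ^ k := by
    ext k; rw [Real.rpow_add hp.1, Real.rpow_natCast]; ring
  rw [this]
  exact (summable_geometric_of_lt_one hp.1.le hp.2).mul_left _

lemma summable_log_shift {p : ℝ} (hp : p ∈ Ioo (0 : ℝ) 1) (c t : ℝ) :
    Summable (fun k : ℕ => Real.log (1 + c * p ^ (t + k))) :=
  Real.summable_log_one_add_of_summable (summable_pow_shift hp c t)

lemma hasDerivAt_h {p : ℝ} (hp : p ∈ Ioo (0 : ℝ) 1) (c t : ℝ) (h : 1 + c * p ^ t ≠ 0) :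
    HasDerivAt (fun t : ℝ => Real.log (1 + c * p ^ t))
      (Real.log p * (1 - (1 + c * p ^ t)⁻¹)) t := by
  have h1 := ((((hasDerivAt_id t).const_rpow hp.1).const_mul c).const_add 1).log h
  simp only [id] at h1
  convert h1 using 1
  field_simp
  ring

lemma convexOn_h {p : ℝ} (hp : p ∈ Ioo (0 : ℝ) 1) (a : ℝ) :
    ConvexOn ℝ (Ioi a) (fun t : ℝ => Real.log (1 + 1 * p ^ t)) := by
  have hpos : ∀ t : ℝ, 0 < 1 + 1 * p ^ t := fun t => by
    have := Real.rpow_pos_of_pos hp.1 t; linarith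
  have hd := fun t => hasDerivAt_h hp 1 t (hpos t).ne'
  apply MonotoneOn.convexOn_of_deriv (convex_Ioi a)
  · exact fun t _ => (hd t).continuousAt.continuousWithinAt
  · exact fun t _ => (hd t).differentiableAt.differentiableWithinAt
  · intro x _ y _ hxy
    rw [(hd x).deriv, (hd y).deriv]
    apply mul_le_mul_of_nonpos_left _ (Real.log_neg hp.1 hp.2).le
    have := Real.rpow_le_rpow_of_exponent_ge hp.1 hp.2.le hxy
    have : (1 + 1 * p ^ x)⁻¹ ≤ (1 + 1 * p ^ y)⁻¹ := inv_anti₀ (hpos y) (by linarith)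
    linarith

lemma concaveOn_h {p : ℝ} (hp : p ∈ Ioo (0 : ℝ) 1) :
    ConvexOn ℝ (Ioi 0) (fun t : ℝ => -Real.log (1 + (-1) * p ^ t)) := by
  have hpos : ∀ t : ℝ, t ∈ Ioi (0 : ℝ) → 0 < 1 + (-1) * p ^ t := fun t ht => by
    have := Real.rpow_lt_one hp.1.le hp.2 ht; linarith
  have hd := fun t (ht : t ∈ Ioi (0 : ℝ)) => (hasDerivAt_h hp (-1) t (hpos t ht).ne').fun_neg
  apply MonotoneOn.convexOn_of_deriv (convex_Ioi 0)
  · exact fun t ht => (hd t ht).continuousAt.continuousWithinAt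
  · rw [interior_Ioi]
    exact fun t ht => (hd t ht).differentiableAt.differentiableWithinAt
  · rw [interior_Ioi]
    intro x hx y hy hxy
    rw [(hd x hx).deriv, (hd y hy).deriv]
    apply neg_le_neg
    apply mul_le_mul_of_nonpos_left _ (Real.log_neg hp.1 hp.2).le
    have := Real.rpow_le_rpow_of_exponent_ge hp.1 hp.2.le hxy
    have : (1 + (-1) * p ^ y)⁻¹ ≤ (1 + (-1) * p ^ x)⁻¹ := inv_anti₀ (hpos x hx) (by linarith)
    linarith

lemma qPochInf_exp {p c t : ℝ} (hp : p ∈ Ioo (0 : ℝ) 1)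
    (hpos : ∀ k : ℕ, 0 < 1 + c * p ^ (t + k)) :
    qPochInf (-(c * p ^ t)) p = Real.exp (∑' k : ℕ, Real.log (1 + c * p ^ (t + k))) := by
  rw [Real.rexp_tsum_eq_tprod hpos (summable_log_shift hp c t), qPochInf]
  congr 1; ext k
  rw [Real.rpow_add hp.1, Real.rpow_natCast]; ring

lemma pos_plus {p : ℝ} (hp : p ∈ Ioo (0 : ℝ) 1) (t : ℝ) : 0 < 1 + 1 * p ^ t := by
  have := Real.rpow_pos_of_pos hp.1 t; linarith

lemma pos_minus {p : ℝ} (hp : p ∈ Ioo (0 : ℝ) 1) {t : ℝ} (ht : 0 < t) :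
    0 < 1 + (-1) * p ^ t := by
  have := Real.rpow_lt_one hp.1.le hp.2 ht; linarith

/-- `(-p^v;p)_∞/(-p^u;p)_∞` bounds (logarithmic) -/
lemma plus_ratio_tendsto {u v : ℝ} (huv : u ≤ v) :
    Tendsto (fun p : ℝ => qPochInf (-(p ^ v)) p / qPochInf (-(p ^ u)) p) (𝓝[Ioo 0 1] 1)
      (𝓝 (Real.exp ((v - u) * (-Real.log 2)))) := by
  have hlog : ∀ w : ℝ, Tendsto (fun p : ℝ => Real.exp ((v - u) * (-Real.log (1 + 1 * p ^ w))))
      (𝓝[Ioo 0 1] 1) (𝓝 (Real.exp ((v - u) * (-Real.log 2)))) := by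
    intro w
    have h1 : ContinuousAt (fun p : ℝ => p ^ w) 1 :=
      Real.continuousAt_rpow_const 1 w (Or.inl one_ne_zero)
    have h2 : ContinuousAt (fun p : ℝ => Real.exp ((v - u) * (-Real.log (1 + 1 * p ^ w)))) 1 := by
      apply ContinuousAt.rexp
      apply continuousAt_const.mul
      apply ContinuousAt.neg
      apply ContinuousAt.log
      · fun_prop
      · norm_num
    have h3 := h2.tendsto
    norm_num at h3
    have h4 := h3.mono_left (nhdsWithin_le_nhds (s := Ioo 0 1))
    simpa using h4
  apply tendsto_of_tendsto_of_tendsto_of_le_of_le' (hlog (u - 1)) (hlog v)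
  all_goals
    filter_upwards [self_mem_nhdsWithin] with p hp
    have e : ∀ t : ℝ, qPochInf (-(p ^ t)) p =
        Real.exp (∑' k : ℕ, Real.log (1 + 1 * p ^ (t + k))) := by
      intro t
      rw [← qPochInf_exp hp (fun k => pos_plus hp _), one_mul]
    rw [e, e, ← Real.exp_sub, Real.exp_le_exp]
    have := convex_tele (convexOn_h hp (u - 2)) (by linarith) huv
      (fun t => summable_log_shift hp 1 t)
  · exact this.1
  · exact this.2

lemma plus_ratio_tendsto' (u v : ℝ) :
    Tendsto (fun p : ℝ => qPochInf (-(p ^ v)) p / qPochInf (-(p ^ u)) p) (𝓝[Ioo 0 1] 1)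
      (𝓝 (Real.exp ((v - u) * (-Real.log 2)))) := by
  rcases le_total u v with h | h
  · exact plus_ratio_tendsto h
  · have := (plus_ratio_tendsto h).inv₀ (Real.exp_pos _).ne'
    rw [← Real.exp_neg] at this
    convert this using 2
    · rw [inv_div]
    · congr 1; ring

lemma qNumber_tendsto (y : ℝ) : Tendsto (fun p => qNumber p y) (𝓝[Ioo 0 1] 1) (𝓝 y) := by
  have h := Real.hasDerivAt_rpow_const (x := 1) (p := y) (Or.inl one_ne_zero)
  rw [hasDerivAt_iff_tendsto_slope] at h
  have h2 := h.mono_left (nhdsWithin_mono (1 : ℝ) (s := Ioo 0 1) (by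
    intro x hx; simp only [mem_compl_iff, mem_singleton_iff]; exact hx.2.ne))
  simp only [Real.one_rpow, mul_one] at h2
  refine h2.congr fun p => ?_
  rw [slope_def_field, qNumber, Real.one_rpow, ← neg_sub 1 (p ^ y), ← neg_sub 1 p, neg_div_neg_eq]

lemma qNumber_pos {p y : ℝ} (hp : p ∈ Ioo (0 : ℝ) 1) (hy : 0 < y) : 0 < qNumber p y := by
  have := Real.rpow_lt_one hp.1.le hp.2 hy
  exact div_pos (by linarith) (by linarith [hp.2])

lemma minus_shift {p s : ℝ} (hp : p ∈ Ioo (0 : ℝ) 1) (hs : 0 < s) (N : ℕ) :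
    qPochInf (p ^ s) p = (∏ k ∈ Finset.range N, (1 - p ^ (s + k))) * qPochInf (p ^ (s + N)) p := by
  have e : ∀ t : ℝ, 0 < t → qPochInf (p ^ t) p =
        Real.exp (∑' k : ℕ, Real.log (1 + (-1) * p ^ (t + k))) := by
    intro t ht
    rw [← qPochInf_exp hp (fun k => pos_minus hp (by positivity))]; simp
  rw [e s hs, e (s + N) (by positivity), ← (summable_log_shift hp (-1) s).sum_add_tsum_nat_add N,
    Real.exp_add, Real.exp_sum]
  congr 1
  · apply Finset.prod_congr rfl
    intro k _
    rw [Real.exp_log (pos_minus hp (by positivity))]; ring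
  · congr 2; ext k; congr 4; push_cast; ring

lemma minus_pos {p s : ℝ} (hp : p ∈ Ioo (0 : ℝ) 1) (hs : 0 < s) : 0 < qPochInf (p ^ s) p := by
  have := qPochInf_exp (c := -1) hp (fun k => pos_minus hp (t := s + k) (by positivity))
  simp only [neg_mul, one_mul, neg_neg] at this
  rw [this]; exact Real.exp_pos _

lemma minus_ratio {p u v : ℝ} (hp : p ∈ Ioo (0 : ℝ) 1) (hu : 1 < u) (huv : u ≤ v) :
    (1 - p ^ v) ^ (-(v - u)) ≤ qPochInf (p ^ v) p / qPochInf (p ^ u) p ∧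
    qPochInf (p ^ v) p / qPochInf (p ^ u) p ≤ (1 - p ^ (u - 1)) ^ (-(v - u)) := by
  have e : ∀ t : ℝ, 0 < t → qPochInf (p ^ t) p =
        Real.exp (∑' k : ℕ, Real.log (1 + (-1) * p ^ (t + k))) := by
    intro t ht
    rw [← qPochInf_exp hp (fun k => pos_minus hp (by positivity))]; simp
  have := convex_tele (concaveOn_h hp) (u := u) (v := v) (by linarith) huv
      (fun t => (summable_log_shift hp (-1) t).neg)
  simp only [tsum_neg] at this
  have h1 := pos_minus hp (t := v) (by linarith)
  have h2 := pos_minus hp (t := u - 1) (by linarith)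
  rw [e v (by linarith), e u (by linarith), ← Real.exp_sub,
    show 1 - p ^ v = 1 + (-1) * p ^ v by ring,
    show 1 - p ^ (u - 1) = 1 + (-1) * p ^ (u - 1) by ring, Real.rpow_def_of_pos h1,
    Real.rpow_def_of_pos h2, Real.exp_le_exp, Real.exp_le_exp]
  constructor <;> linarith [this.1, this.2]

lemma qGamma_tendsto {s : ℝ} (hs : 0 < s) :
    Tendsto (fun p : ℝ => (1 - p) ^ (s - 1) * (qPochInf (p ^ s) p / qPochInf p p)) (𝓝[Ioo 0 1] 1)
      (𝓝 (Real.Gamma s)⁻¹) := by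
  let E : ℕ → ℝ → ℝ := fun n p => (∏ k ∈ Finset.range (n + 1), qNumber p (s + k)) /
    ∏ k ∈ Finset.range n, qNumber p (1 + k)
  let e : ℕ → ℝ := fun n => (∏ k ∈ Finset.range (n + 1), (s + k)) /
    ∏ k ∈ Finset.range n, (1 + k : ℝ)
  have hE : ∀ n, Tendsto (E n) (𝓝[Ioo 0 1] 1) (𝓝 (e n)) := by
    intro n
    apply Tendsto.div
    · exact tendsto_finsetProd _ fun k _ => qNumber_tendsto _
    · exact tendsto_finsetProd _ fun k _ => qNumber_tendsto _
    · exact (Finset.prod_pos fun k _ => by positivity).ne'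
  have he : ∀ n : ℕ, 1 ≤ n → e n * (n : ℝ) ^ (-s) = (Real.GammaSeq s n)⁻¹ := by
    intro n hn
    have hn' : (0 : ℝ) < n := by exact_mod_cast hn
    have : ∏ k ∈ Finset.range n, (1 + k : ℝ) = n.factorial := by
      rw [← Finset.prod_range_add_one_eq_factorial]; push_cast
      exact Finset.prod_congr rfl fun k _ => by ring
    simp only [e, this, Real.GammaSeq]
    rw [Real.rpow_neg hn'.le, inv_div]
    field_simp
  have hGs := (Real.GammaSeq_tendsto_Gamma s).inv₀ (Real.Gamma_pos_of_pos hs).ne'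
  have hid : ∀ p ∈ Ioo (0 : ℝ) 1, ∀ n : ℕ,
      (1 - p) ^ (s - 1) * (qPochInf (p ^ s) p / qPochInf p p) =
      E n p * (1 - p) ^ s * (qPochInf (p ^ (s + (n + 1 : ℕ))) p / qPochInf (p ^ (1 + n : ℝ)) p) := by
    intro p hp n
    have h1p : 0 < 1 - p := by linarith [hp.2]
    have a1 := minus_shift hp hs (n + 1)
    have a2 := minus_shift hp one_pos n
    rw [Real.rpow_one] at a2
    have e1 : ∏ k ∈ Finset.range (n + 1), qNumber p (s + k) =
        (∏ k ∈ Finset.range (n + 1), (1 - p ^ (s + k))) / (1 - p) ^ (n + 1) := by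
      simp only [qNumber]; rw [Finset.prod_div_distrib]; simp
    have e2 : ∏ k ∈ Finset.range n, qNumber p (1 + k) =
        (∏ k ∈ Finset.range n, (1 - p ^ (1 + k : ℝ))) / (1 - p) ^ n := by
      simp only [qNumber]; rw [Finset.prod_div_distrib]; simp
    have hp1 : (∏ k ∈ Finset.range n, (1 - p ^ (1 + k : ℝ))) ≠ 0 := by
      apply (Finset.prod_pos fun k _ => ?_).ne'
      have := Real.rpow_lt_one hp.1.le hp.2 (show (0 : ℝ) < 1 + k by positivity)
      linarith
    have hq1 := (minus_pos hp (show (0 : ℝ) < 1 + n by positivity)).ne'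
    simp only [E]
    rw [a1, a2, e1, e2, Real.rpow_sub_one h1p.ne']
    field_simp
    ring
  apply squeeze_two (A := fun n p => E n p * (qNumber p (s + (n + 1 : ℕ))) ^ (-s))
    (B := fun n p => E n p * (qNumber p n) ^ (-s))
    (a := fun n => e n * (s + (n + 1 : ℕ)) ^ (-s)) (b := fun n => e n * (n : ℝ) ^ (-s))
  · intro n hn
    exact (hE n).mul ((qNumber_tendsto _).rpow_const (Or.inl (by positivity)))
  · intro n hn
    have hn' : (0 : ℝ) < n := by exact_mod_cast hn
    exact (hE n).mul ((qNumber_tendsto _).rpow_const (Or.inl hn'.ne'))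
  · have h1 : Tendsto (fun n : ℕ => ((n : ℝ) / (n + (s + 1))) ^ s) atTop (𝓝 (1 ^ s)) :=
      (tendsto_natCast_div_add_atTop (s + 1)).rpow_const (Or.inl one_ne_zero)
    have h2 := hGs.mul h1
    rw [Real.one_rpow, mul_one] at h2
    refine h2.congr' ?_
    filter_upwards [eventually_ge_atTop 1] with n hn
    have hn' : (0 : ℝ) < n := by exact_mod_cast hn
    rw [← he n hn, Real.div_rpow hn'.le (by positivity), Real.rpow_neg hn'.le,
      Real.rpow_neg (by positivity)]
    have : s + ((n + 1 : ℕ) : ℝ) = n + (s + 1) := by push_cast; ring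
    rw [this]
    have := (Real.rpow_pos_of_pos hn' s).ne'
    field_simp
  · refine hGs.congr' ?_
    filter_upwards [eventually_ge_atTop 1] with n hn
    exact (he n hn).symm
  all_goals
    intro n hn
    have hn' : (0 : ℝ) < n := by exact_mod_cast hn
    filter_upwards [self_mem_nhdsWithin] with p hp
    have h1p : 0 < 1 - p := by linarith [hp.2]
    have hEpos : 0 ≤ E n p := by
      apply div_nonneg <;> apply Finset.prod_nonneg <;> intro k _ <;>
        exact (qNumber_pos hp (by positivity)).le
    have hb := minus_ratio hp (u := 1 + n) (v := s + (n + 1 : ℕ)) (by linarith)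
      (by push_cast; linarith)
    rw [show s + ((n + 1 : ℕ) : ℝ) - (1 + n) = s by push_cast; ring,
      show (1 : ℝ) + n - 1 = n by ring] at hb
    have hr : ∀ y : ℝ, 0 < y → (qNumber p y) ^ (-s) = (1 - p) ^ s * (1 - p ^ y) ^ (-s) := by
      intro y hy
      have := Real.rpow_lt_one hp.1.le hp.2 hy
      rw [qNumber, Real.div_rpow (by linarith) h1p.le, Real.rpow_neg h1p.le, div_inv_eq_mul,
        mul_comm]
    rw [hid p hp n, hr _ (by positivity), mul_assoc]
    have := (Real.rpow_pos_of_pos h1p s).le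
  · gcongr
    exact hb.1
  · gcongr
    exact hb.2

lemma omega_tendsto (α x : ℝ) :
    Tendsto (fun q : ℝ => omegaAlpha q α (Real.sqrt (1 - q ^ 2) * x)) (𝓝[Ioo 0 1] 1)
      (𝓝 (Real.exp (-x ^ 2))) := by
  let b : ℝ → ℝ := fun q => q ^ (-(2 * α + 1)) * x ^ 2
  have hb : Tendsto b (𝓝[Ioo 0 1] 1) (𝓝 (x ^ 2)) := by
    have h1 : ContinuousAt (fun p : ℝ => p ^ (-(2 * α + 1))) 1 :=
      Real.continuousAt_rpow_const 1 _ (Or.inl one_ne_zero)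
    have h2 := h1.tendsto.mul_const (x ^ 2)
    rw [Real.one_rpow, one_mul] at h2
    exact h2.mono_left nhdsWithin_le_nhds
  have hq2 : Tendsto (fun q : ℝ => 1 - q ^ 2) (𝓝[Ioo 0 1] 1) (𝓝 0) := by
    have : ContinuousAt (fun q : ℝ => 1 - q ^ 2) 1 := by fun_prop
    have := this.tendsto
    norm_num at this
    exact this.mono_left nhdsWithin_le_nhds
  have hlow : Tendsto (fun q => b q / (1 + b q * (1 - q ^ 2))) (𝓝[Ioo 0 1] 1) (𝓝 (x ^ 2)) := by
    have := hb.div ((hb.mul hq2).const_add 1) (by simp)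
    rw [mul_zero, add_zero, div_one] at this
    exact this
  let S : ℝ → ℝ := fun q => ∑' k : ℕ, Real.log (1 + (b q * (1 - q ^ 2)) * (q ^ 2) ^ k)
  have hfacts : ∀ q ∈ Ioo (0 : ℝ) 1, 0 ≤ b q * (1 - q ^ 2) ∧
      HasSum (fun k : ℕ => (b q * (1 - q ^ 2)) * (q ^ 2) ^ k) (b q) ∧ 0 < q ^ 2 ∧ q ^ 2 < 1 := by
    intro q hq
    have h2 : q ^ 2 < 1 := by nlinarith [hq.1, hq.2]
    have h0 : 0 < q ^ 2 := by have := hq.1; positivity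
    have h3 : 0 ≤ b q := mul_nonneg (Real.rpow_nonneg hq.1.le _) (sq_nonneg x)
    refine ⟨mul_nonneg h3 (by linarith), ?_, h0, h2⟩
    have := (hasSum_geometric_of_lt_one h0.le h2).mul_left (b q * (1 - q ^ 2))
    rwa [mul_assoc (b q) _ (_⁻¹), mul_inv_cancel₀ (by linarith), mul_one] at this
  have hS : Tendsto S (𝓝[Ioo 0 1] 1) (𝓝 (x ^ 2)) := by
    apply tendsto_of_tendsto_of_tendsto_of_le_of_le' hlow hb
    all_goals
      filter_upwards [self_mem_nhdsWithin] with q hq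
      obtain ⟨h0, hs, hq0, hq1⟩ := hfacts q hq
      have hsl := Real.summable_log_one_add_of_summable hs.summable
    · have h5 := hs.div_const (1 + b q * (1 - q ^ 2))
      rw [← h5.tsum_eq]
      apply h5.summable.tsum_le_tsum _ hsl
      intro k
      have hk : (q ^ 2) ^ k ≤ 1 := pow_le_one₀ hq0.le hq1.le
      have hk0 : 0 ≤ (q ^ 2) ^ k := by positivity
      set a := b q * (1 - q ^ 2)
      have hy : 0 ≤ a * (q ^ 2) ^ k := mul_nonneg h0 hk0
      refine le_trans ?_ (Real.one_sub_inv_le_log_of_pos (by linarith))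
      have : 1 - (1 + a * (q ^ 2) ^ k)⁻¹ = a * (q ^ 2) ^ k / (1 + a * (q ^ 2) ^ k) := by
        have : 1 + a * (q ^ 2) ^ k ≠ 0 := by linarith
        field_simp; ring
      rw [this]
      apply div_le_div_of_nonneg_left hy (by linarith)
      nlinarith
    · rw [← hs.tsum_eq]
      apply hsl.tsum_le_tsum _ hs.summable
      intro k
      have hk0 : 0 ≤ (q ^ 2) ^ k := by positivity
      have hy := mul_nonneg h0 hk0
      have := Real.log_le_sub_one_of_pos (show 0 < 1 + (b q * (1 - q ^ 2)) * (q ^ 2) ^ k by linarith)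
      linarith
  have := (Real.continuous_exp.tendsto _).comp hS.neg
  refine this.congr' ?_
  filter_upwards [self_mem_nhdsWithin] with q hq
  obtain ⟨h0, hs, hq0, hq1⟩ := hfacts q hq
  have hsl := Real.summable_log_one_add_of_summable hs.summable
  have hpos : ∀ k : ℕ, 0 < 1 + (b q * (1 - q ^ 2)) * (q ^ 2) ^ k := fun k => by
    have hk0 : 0 ≤ (q ^ 2) ^ k := by positivity
    have := mul_nonneg h0 hk0
    linarith
  simp only [Function.comp, S]
  rw [Real.exp_neg, Real.rexp_tsum_eq_tprod hpos hsl, omegaAlpha]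
  congr 2; ext k
  rw [mul_pow, Real.sq_sqrt (by linarith), pow_mul]
  simp only [b]; ring

lemma sq_tendsto : Tendsto (fun q : ℝ => q ^ 2) (𝓝[Ioo 0 1] 1) (𝓝[Ioo 0 1] 1) := by
  apply tendsto_nhdsWithin_of_tendsto_nhds_of_eventually_within
  · have : ContinuousAt (fun q : ℝ => q ^ 2) 1 := by fun_prop
    have := this.tendsto
    rw [one_pow] at this
    exact this.mono_left nhdsWithin_le_nhds
  · filter_upwards [self_mem_nhdsWithin] with q hq
    exact ⟨by have := hq.1; positivity, by nlinarith [hq.1, hq.2]⟩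

lemma cont_tendsto {f : ℝ → ℝ} (hf : ContinuousAt f 1) :
    Tendsto f (𝓝[Ioo 0 1] 1) (𝓝 (f 1)) := hf.tendsto.mono_left nhdsWithin_le_nhds

lemma plus_pos {p : ℝ} (hp : p ∈ Ioo (0 : ℝ) 1) (t : ℝ) : 0 < qPochInf (-(p ^ t)) p := by
  have := qPochInf_exp (c := 1) (t := t) hp (fun k => pos_plus hp _)
  rw [one_mul] at this
  rw [this]; exact Real.exp_pos _

lemma c_tendsto {α : ℝ} (hα : -1 < α) :
    Tendsto (fun q : ℝ => (1 - q ^ 2) ^ ((α + 1) / 2) * cAlpha q α) (𝓝[Ioo 0 1] 1)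
      (𝓝 (Real.sqrt (Real.Gamma (α + 1))⁻¹)) := by
  have hA := (plus_ratio_tendsto' (1 / 2) (-α - 1 / 2)).comp sq_tendsto
  have hB := (plus_ratio_tendsto' (1 / 2) (α + 3 / 2)).comp sq_tendsto
  have hG := (qGamma_tendsto (s := α + 1) (by linarith)).comp sq_tendsto
  have hq : Tendsto (fun q : ℝ => (1 + q) / 2) (𝓝[Ioo 0 1] 1) (𝓝 1) := by
    have := cont_tendsto (f := fun q : ℝ => (1 + q) / 2) (by fun_prop)
    norm_num at this
    simpa using this
  have h := (((hA.mul hB).mul hG).mul hq).sqrt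
  rw [← Real.exp_add, show (-α - 1 / 2 - 1 / 2) * -Real.log 2 + (α + 3 / 2 - 1 / 2) * -Real.log 2
    = 0 by ring, Real.exp_zero, one_mul, mul_one] at h
  refine h.congr' ?_
  filter_upwards [self_mem_nhdsWithin] with q hq
  have hp : q ^ 2 ∈ Ioo (0 : ℝ) 1 :=
    ⟨by have := hq.1; positivity, by nlinarith [hq.1, hq.2]⟩
  have hpp : 0 < 1 - q ^ 2 := by linarith [hp.2]
  have h1q : 0 < 1 - q := by linarith [hq.2]
  have er : ∀ t : ℝ, (q ^ 2) ^ t = q ^ (2 * t) := fun t => by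
    rw [Real.rpow_mul hq.1.le]; norm_num
  have hC := (plus_pos hp (1 / 2)).ne'
  have hD := (minus_pos hp one_pos).ne'
  rw [Real.rpow_one] at hD
  simp only [Function.comp]
  have e1 : (q ^ 2) ^ (-α - 1 / 2) = q ^ (-(2 * α + 1)) := by rw [er]; congr 1; ring
  have e2 : (q ^ 2) ^ (α + 3 / 2) = q ^ (2 * α + 3) := by rw [er]; congr 1; ring
  have e3 : (q ^ 2) ^ (α + 1) = q ^ (2 * α + 2) := by rw [er]; congr 1; ring
  have e4 : (q ^ 2) ^ (1 / 2 : ℝ) = q := by rw [er]; norm_num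
  have e5 : (1 - q ^ 2) ^ ((α + 1) / 2) = Real.sqrt ((1 - q ^ 2) ^ (α + 1)) := by
    rw [Real.sqrt_eq_rpow, ← Real.rpow_mul hpp.le]; congr 1; ring
  rw [e4] at hC
  rw [e1, e2, e3, e4, e5, cAlpha, ← Real.sqrt_mul (Real.rpow_nonneg hpp.le _)]
  congr 1
  rw [Real.rpow_sub_one hpp.ne', show 1 - q ^ 2 = (1 - q) * (1 + q) by ring]
  have h2q : 0 < 1 + q := by linarith [hq.1]
  generalize ((1 - q) * (1 + q)) ^ (α + 1) = Z
  field_simp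

lemma qFact_tendsto {α : ℝ} (hα : -1 < α) (n : ℕ) :
    Tendsto (fun q : ℝ => qFactAlpha q α n) (𝓝[Ioo 0 1] 1) (𝓝 (gammaGen (α + 1 / 2) n)) := by
  induction n with
  | zero =>
    have := (Real.Gamma_pos_of_pos (show 0 < α + 1 by linarith)).ne'
    have h : gammaGen (α + 1 / 2) 0 = 1 := by
      simp only [gammaGen]
      norm_num
      rw [show α + 1 / 2 + 1 / 2 = α + 1 by ring]
      exact this
    rw [h]
    simp [qFactAlpha]
  | succ n ih =>
    simp only [qFactAlpha, Finset.prod_range_succ]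
    simp only [qFactAlpha] at ih
    rcases Nat.even_or_odd' n with ⟨m, rfl | rfl⟩
    · have hq : Tendsto (fun q : ℝ => qNumAlpha q α (2 * m + 1)) (𝓝[Ioo 0 1] 1)
          (𝓝 (2 * m + 1 + 2 * α + 1)) := by
        have h : (2 * m + 1) % 2 ≠ 0 := by omega
        simp only [qNumAlpha, h, if_false]
        have := qNumber_tendsto (((2 * m + 1 : ℕ) : ℝ) + 2 * α + 1)
        push_cast at this ⊢
        exact this
      convert ih.mul hq using 2
      simp only [gammaGen]
      rw [show (2 * m + 1) / 2 = m by omega, show (2 * m + 1 + 1) / 2 = m + 1 by omega,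
        show 2 * m / 2 = m by omega]
      push_cast
      have hm : (0 : ℝ) ≤ m := Nat.cast_nonneg m
      rw [show α + 1 / 2 + ((m : ℝ) + 1) + 1 / 2 = (α + 1 / 2 + m + 1 / 2) + 1 by ring,
        Real.Gamma_add_one (by linarith)]
      ring
    · have hq : Tendsto (fun q : ℝ => qNumAlpha q α (2 * m + 1 + 1)) (𝓝[Ioo 0 1] 1)
          (𝓝 (2 * m + 1 + 1)) := by
        have h : (2 * m + 1 + 1) % 2 = 0 := by omega
        simp only [qNumAlpha, h, if_true]
        have := qNumber_tendsto ((2 * m + 1 + 1 : ℕ) : ℝ)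
        push_cast at this ⊢
        exact this
      convert ih.mul hq using 2
      simp only [gammaGen]
      rw [show (2 * m + 1) / 2 = m by omega, show (2 * m + 1 + 1) / 2 = m + 1 by omega,
        show (2 * m + 1 + 1 + 1) / 2 = m + 1 by omega, Nat.factorial_succ]
      push_cast
      ring

lemma gammaGen_pos {α : ℝ} (hα : -1 < α) (n : ℕ) : 0 < gammaGen (α + 1 / 2) n := by
  have h1 := Real.Gamma_pos_of_pos (show 0 < α + 1 / 2 + 1 / 2 by linarith)
  have h2 := Real.Gamma_pos_of_pos (show 0 < α + 1 / 2 + (((n + 1) / 2 : ℕ) : ℝ) + 1 / 2 by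
    have : (0 : ℝ) ≤ (((n + 1) / 2 : ℕ) : ℝ) := Nat.cast_nonneg _
    linarith)
  unfold gammaGen
  positivity

lemma qPoch_tendsto (k : ℕ) :
    Tendsto (fun q : ℝ => qPoch (q ^ 2) (q ^ 2) k / (1 - q ^ 2) ^ k) (𝓝[Ioo 0 1] 1)
      (𝓝 (Nat.factorial k : ℝ)) := by
  have h : Tendsto (fun p : ℝ => ∏ j ∈ Finset.range k, qNumber p (j + 1 : ℕ)) (𝓝[Ioo 0 1] 1)
      (𝓝 (∏ j ∈ Finset.range k, ((j + 1 : ℕ) : ℝ))) :=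
    tendsto_finsetProd _ fun j _ => qNumber_tendsto _
  have e : (∏ j ∈ Finset.range k, ((j + 1 : ℕ) : ℝ)) = (Nat.factorial k : ℝ) := by
    rw [← Finset.prod_range_add_one_eq_factorial]; push_cast; rfl
  rw [e] at h
  refine (h.comp sq_tendsto).congr fun q => ?_
  simp only [Function.comp, qNumber, qPoch]
  rw [Finset.prod_div_distrib]
  simp only [Finset.prod_const, Finset.card_range]
  congr 1
  apply Finset.prod_congr rfl
  intro j _
  rw [Real.rpow_natCast, pow_succ]; ring

lemma sum_tendsto {α : ℝ} (hα : -1 < α) (n : ℕ) (x : ℝ) :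
    Tendsto (fun q : ℝ => ∑ k ∈ Finset.range (n / 2 + 1),
      (-1 : ℝ) ^ k * q ^ ((k * (2 * k + 1) : ℤ) - (2 * n * k : ℤ)) * ((1 + q) * x) ^ (n - 2 * k) /
        (qPoch (q ^ 2) (q ^ 2) k / (1 - q ^ 2) ^ k * qFactAlpha q α (n - 2 * k)))
      (𝓝[Ioo 0 1] 1) (𝓝 (HGen (α + 1 / 2) n x / (Nat.factorial n : ℝ))) := by
  rw [HGen, mul_div_cancel_left₀ _ (by positivity)]
  apply tendsto_finsetSum
  intro k _
  apply Tendsto.div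
  · have h1 : ContinuousAt (fun q : ℝ => q ^ ((k * (2 * k + 1) : ℤ) - (2 * n * k : ℤ))) 1 :=
      continuousAt_zpow₀ _ _ (Or.inl one_ne_zero)
    have := cont_tendsto (f := fun q : ℝ => (-1 : ℝ) ^ k *
      q ^ ((k * (2 * k + 1) : ℤ) - (2 * n * k : ℤ)) * ((1 + q) * x) ^ (n - 2 * k)) (by fun_prop)
    simp only [one_zpow, mul_one] at this
    norm_num only at this
    exact this
  · exact (qPoch_tendsto k).mul (qFact_tendsto hα _)
  · have := gammaGen_pos hα (n - 2 * k)
    positivity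

lemma phiQ_eq {α : ℝ} (hα : -1 < α) (n : ℕ) (x : ℝ) {q : ℝ} (hq : q ∈ Ioo (0 : ℝ) 1) :
    (1 - q ^ 2) ^ ((α + 1) / 2) * phiQ q α n (Real.sqrt (1 - q ^ 2) * x) =
    ((1 - q ^ 2) ^ ((α + 1) / 2) * cAlpha q α) * q ^ (((n : ℝ) ^ 2) / 2) *
      Real.sqrt (qFactAlpha q α n) * (Real.sqrt (1 + q) ^ n)⁻¹ *
      Real.sqrt (omegaAlpha q α (Real.sqrt (1 - q ^ 2) * x)) *
      ∑ k ∈ Finset.range (n / 2 + 1),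
      (-1 : ℝ) ^ k * q ^ ((k * (2 * k + 1) : ℤ) - (2 * n * k : ℤ)) * ((1 + q) * x) ^ (n - 2 * k) /
        (qPoch (q ^ 2) (q ^ 2) k / (1 - q ^ 2) ^ k * qFactAlpha q α (n - 2 * k)) := by
  have h1q : 0 < 1 - q := by linarith [hq.2]
  have h2q : 0 < 1 + q := by linarith [hq.1]
  set r := Real.sqrt (1 - q) with hr
  set w := Real.sqrt (1 + q) with hw
  have hr0 : 0 < r := Real.sqrt_pos.2 h1q
  have hw0 : 0 < w := Real.sqrt_pos.2 h2q
  have hr2 : 1 - q = r ^ 2 := (Real.sq_sqrt h1q.le).symm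
  have hw2 : 1 + q = w ^ 2 := (Real.sq_sqrt h2q.le).symm
  have hpoch : qPoch q q n ≠ 0 := by
    apply (Finset.prod_pos fun k _ => ?_).ne'
    have : q * q ^ k < 1 := by
      rw [← pow_succ']; exact pow_lt_one₀ hq.1.le hq.2 (by omega)
    linarith
  have hs : Real.sqrt (1 - q ^ 2) = r * w := by
    rw [hr, hw, ← Real.sqrt_mul h1q.le]; congr 1; ring
  have hp2 : 1 - q ^ 2 = (r * w) ^ 2 := by rw [mul_pow, ← hr2, ← hw2]; ring
  have hsq : Real.sqrt (qPochAlpha q α n) = r ^ n * Real.sqrt (qFactAlpha q α n) := by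
    rw [qPochAlpha, Real.sqrt_mul (by positivity)]
    congr 1
    rw [hr2, ← pow_mul, mul_comm 2 n, pow_mul, Real.sqrt_sq (by positivity)]
  have hsum : ∀ y : ℝ, y = Real.sqrt (1 - q ^ 2) * x → r ^ n * ∑ k ∈ Finset.range (n / 2 + 1),
    (-1 : ℝ) ^ k * q ^ ((k * (2 * k + 1) : ℤ) - (2 * n * k : ℤ)) * y ^ (n - 2 * k) /
      (qPoch (q ^ 2) (q ^ 2) k * qPochAlpha q α (n - 2 * k)) = (w ^ n)⁻¹ *
      ∑ k ∈ Finset.range (n / 2 + 1),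
      (-1 : ℝ) ^ k * q ^ ((k * (2 * k + 1) : ℤ) - (2 * n * k : ℤ)) * ((1 + q) * x) ^ (n - 2 * k) /
        (qPoch (q ^ 2) (q ^ 2) k / (1 - q ^ 2) ^ k * qFactAlpha q α (n - 2 * k)) := by
    rintro y rfl
    rw [Finset.mul_sum, Finset.mul_sum]
    apply Finset.sum_congr rfl
    intro k hk
    obtain ⟨m, hm⟩ : ∃ m, n = m + 2 * k := ⟨n - 2 * k, by
      have := Finset.mem_range.1 hk; omega⟩
    have hm' : n - 2 * k = m := by omega
    rw [hm', hs, hp2, hw2, qPochAlpha, hr2]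
    generalize q ^ ((k * (2 * k + 1) : ℤ) - (2 * n * k : ℤ)) = Z
    rw [hm]
    generalize qPoch (q ^ 2) (q ^ 2) k = P
    generalize qFactAlpha q α m = F
    have c1 : r ^ (m + 2 * k) * ((r * w) * x) ^ m * w ^ (m + 2 * k) =
      (w ^ 2 * x) ^ m * ((r * w) ^ 2) ^ k * (r ^ 2) ^ m := by ring
    have hw' : w ^ (m + 2 * k) ≠ 0 := by positivity
    have hr' : (r ^ 2) ^ m ≠ 0 := by positivity
    calc r ^ (m + 2 * k) * ((-1) ^ k * Z * (r * w * x) ^ m / (P * ((r ^ 2) ^ m * F)))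
        = (r ^ (m + 2 * k) * ((r * w) * x) ^ m * w ^ (m + 2 * k)) *
          ((-1) ^ k * Z / (P * F)) / ((r ^ 2) ^ m * w ^ (m + 2 * k)) := by
          rw [mul_div_assoc, eq_div_iff (by positivity)]
          simp only [div_eq_mul_inv, mul_inv]
          field_simp
      _ = _ := by
          rw [c1]
          simp only [div_eq_mul_inv, mul_inv, inv_inv]
          field_simp
  have hsum := hsum _ rfl
  rw [phiQ, dAlpha, hTilde, hsq]
  generalize (∑ k ∈ Finset.range (n / 2 + 1),
    (-1 : ℝ) ^ k * q ^ ((k * (2 * k + 1) : ℤ) - (2 * n * k : ℤ)) *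
      (Real.sqrt (1 - q ^ 2) * x) ^ (n - 2 * k) /
      (qPoch (q ^ 2) (q ^ 2) k * qPochAlpha q α (n - 2 * k))) = S1 at hsum ⊢
  rw [mul_assoc _ (Real.sqrt (omegaAlpha _ _ _)) _, mul_assoc _ ((w ^ n)⁻¹) _,
    mul_comm ((w ^ n)⁻¹), mul_assoc _ _ (∑ k ∈ Finset.range (n / 2 + 1), _),
    mul_assoc (Real.sqrt (omegaAlpha _ _ _)) _ (∑ k ∈ Finset.range (n / 2 + 1), _), ← hsum]
  field_simp

/-- limit of the (q,α)-deformed Hermite functions to the Rosenblum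
generalized Hermite functions. -/
theorem stmt_17 (α : ℝ) (hα : -1 < α) (n : ℕ) (x : ℝ) :
    Tendsto (fun q : ℝ =>
        (1 - q ^ 2) ^ ((α + 1) / 2) * phiQ q α n (Real.sqrt (1 - q ^ 2) * x))
      (nhdsWithin 1 (Set.Ioo 0 1))
      (nhds (phiGen (α + 1 / 2) n x)) := by

  have hc := c_tendsto hα
  have hq := cont_tendsto (f := fun q : ℝ => q ^ (((n : ℝ) ^ 2) / 2))
    (Real.continuousAt_rpow_const 1 _ (Or.inl one_ne_zero))
  have hw := (cont_tendsto (f := fun q : ℝ => Real.sqrt (1 + q) ^ n) (by fun_prop)).inv₀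
    (by positivity)
  have h := ((((hc.mul hq).mul (qFact_tendsto hα n).sqrt).mul hw).mul
    (omega_tendsto α x).sqrt).mul (sum_tendsto hα n x)
  have h' := h.congr' (f₂ := fun q : ℝ =>
        (1 - q ^ 2) ^ ((α + 1) / 2) * phiQ q α n (Real.sqrt (1 - q ^ 2) * x)) (by
    filter_upwards [self_mem_nhdsWithin] with q hq
    exact (phiQ_eq hα n x hq).symm)
  convert h' using 2
  rw [phiGen, show α + 1 / 2 + 1 / 2 = α + 1 by ring, Real.one_rpow, mul_one,
    div_eq_mul_inv (gammaGen _ _), Real.sqrt_mul (gammaGen_pos hα n).le]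
  have e1 : Real.sqrt (Real.exp (-x ^ 2)) = Real.exp (-x ^ 2 / 2) := by
    rw [Real.exp_half]
  have e2 : (2 : ℝ) ^ ((n : ℝ) / 2) = Real.sqrt (1 + 1) ^ n := by
    rw [Real.sqrt_eq_rpow, ← Real.rpow_natCast, ← Real.rpow_mul (by norm_num)]
    norm_num
    congr 1; ring
  rw [e1, e2]
  field_simp
end
end
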